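/- arXiv:0911.4279 — 4 statements merged into one kernel-verified Lean document; each statement's English description precedes it below -/
import Mathlib

section
/- Let 0 < s < 1/2 and let β be the Kac cross-section. Let f₀ ∈ L¹_{2+2s}(ℝ) ∩ L log L(ℝ) with f₀ ≥ 0 and f₀ not identically zero, let T₀ > 0, and let f ∈ L∞([0,T₀]; L¹_{2+2s}(ℝ) ∩ L log L(ℝ)) be a nonnegative weak solution of the Cauchy problem ∂_t f = K(f,f), f|_{t=0} = f₀. Then for every 0 < s' < s there exists 0 < T* ≤ T₀ such that for every 0 < t ≤ T* the function f(t,·) belongs to the Gevrey class G^{1/(2s')}(ℝ); that is, there exists c > 0 with ∫_ℝ e^{2c⟨ξ⟩^{2s'}} |𝓕(f(t,·))(ξ)|² dξ < ∞. -/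
open MeasureTheory Real intervalIntegral

noncomputable section

/-- Japanese bracket `⟨v⟩ = (1+v²)^{1/2}`. -/
def jap (v : ℝ) : ℝ := Real.sqrt (1 + v ^ 2)

/-- Fourier transform on `ℝ`: `𝓕u(ξ) = ∫ e^{-2πivξ} u(v) dv`. -/
def FT (u : ℝ → ℂ) (ξ : ℝ) : ℂ :=
  ∫ v : ℝ, Complex.exp (-(2 * Real.pi * v * ξ) * Complex.I) * u v

/-- Kac non-cutoff cross-section `β(θ) = C₀ |cos θ| / |sin θ|^{1+2s}`. -/
def kacBeta (C₀ s θ : ℝ) : ℝ := C₀ * |Real.cos θ| / |Real.sin θ| ^ (1 + 2 * s)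

/-- `f` is a nonnegative weak solution on `[0,T]` of the Cauchy problem for the
spatially homogeneous non-cutoff Kac equation `∂ₜf = K(f,f)`, `f|_{t=0} = f₀`:
the weak formulation holds against all test functions `φ` that are `C¹` in `t`
and `C²` in `v` and bounded together with these derivatives; moreover `f`
conserves mass and energy and satisfies the entropy inequality. -/
structure IsWeakKacSolution (C₀ s T : ℝ) (f₀ : ℝ → ℝ) (f : ℝ → ℝ → ℝ) : Prop where
  nonneg : ∀ t ∈ Set.Icc (0 : ℝ) T, ∀ v : ℝ, 0 ≤ f t v
  weak_eq : ∀ φ φt : ℝ → ℝ → ℝ,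
    (∀ v t : ℝ, HasDerivAt (fun τ => φ τ v) (φt t v) t) →
    (∀ t : ℝ, ContDiff ℝ 2 (fun v => φ t v)) →
    (∃ M : ℝ, ∀ t v : ℝ, |φ t v| ≤ M ∧ |φt t v| ≤ M ∧
        |deriv (fun w => φ t w) v| ≤ M ∧ |deriv (deriv (fun w => φ t w)) v| ≤ M) →
    ∀ t ∈ Set.Icc (0 : ℝ) T,
      (∫ v : ℝ, f t v * φ t v) - ∫ v : ℝ, f₀ v * φ 0 v
        = (∫ τ in (0 : ℝ)..t, ∫ v : ℝ, f τ v * φt τ v)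
          + ∫ τ in (0 : ℝ)..t, ∫ v : ℝ, ∫ vs : ℝ,
              ∫ θ in (-(Real.pi / 2))..(Real.pi / 2),
                kacBeta C₀ s θ * f τ vs * f τ v *
                  (φ τ (v * Real.cos θ - vs * Real.sin θ) - φ τ v)
  mass : ∀ t ∈ Set.Icc (0 : ℝ) T, (∫ v : ℝ, f t v) = ∫ v : ℝ, f₀ v
  energy : ∀ t ∈ Set.Icc (0 : ℝ) T, (∫ v : ℝ, f t v * v ^ 2) = ∫ v : ℝ, f₀ v * v ^ 2
  entropy : ∀ t ∈ Set.Icc (0 : ℝ) T,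
    (∫ v : ℝ, f t v * Real.log (f t v)) ≤ ∫ v : ℝ, f₀ v * Real.log (f₀ v)

/-! ### Uniform strict bound of the Fourier transform away from the origin -/

lemma abs_sin_nat_mul_le (k : ℕ) (x : ℝ) : |Real.sin (k * x)| ≤ k * |Real.sin x| := by
  induction k with
  | zero => simp
  | succ k ih =>
    have h : ((k + 1 : ℕ) : ℝ) * x = k * x + x := by push_cast; ring
    rw [h, Real.sin_add]
    have h1 := Real.abs_cos_le_one x
    have h2 := Real.abs_cos_le_one (k * x)
    calc |Real.sin (k * x) * Real.cos x + Real.cos (k * x) * Real.sin x|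
        ≤ |Real.sin (k * x)| * |Real.cos x| + |Real.cos (k * x)| * |Real.sin x| := by
          rw [← abs_mul, ← abs_mul]; exact abs_add_le _ _
      _ ≤ k * |Real.sin x| * 1 + 1 * |Real.sin x| := by gcongr
      _ = ((k + 1 : ℕ) : ℝ) * |Real.sin x| := by push_cast; ring

lemma tendsto_integral_sin_pow_even :
    Filter.Tendsto (fun n : ℕ => ∫ x in (0 : ℝ)..Real.pi, Real.sin x ^ (2 * n))
      Filter.atTop (nhds 0) := by
  have key : Filter.Tendsto (fun n : ℕ => ∫ x in (0 : ℝ)..Real.pi, Real.sin x ^ (2 * n))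
      Filter.atTop (nhds (∫ _x in (0 : ℝ)..Real.pi, (0 : ℝ))) := by
    refine intervalIntegral.tendsto_integral_filter_of_dominated_convergence (fun _ => 1) ?_ ?_ ?_ ?_
    · exact Filter.Eventually.of_forall fun n => (by fun_prop : Continuous
        (fun x => Real.sin x ^ (2 * n))).aestronglyMeasurable
    · refine Filter.Eventually.of_forall fun n => Filter.Eventually.of_forall fun x _ => ?_
      rw [norm_pow, Real.norm_eq_abs]
      exact pow_le_one₀ (abs_nonneg _) (Real.abs_sin_le_one x)
    · simp
    · have h0 : ∀ᵐ x : ℝ, x ≠ Real.pi / 2 := by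
        simp [ae_iff]
      filter_upwards [h0] with x hx hxI
      rw [Set.uIoc_of_le Real.pi_pos.le] at hxI
      have hlt : |Real.sin x| < 1 := by
        have hcos : Real.cos x ≠ 0 := by
          intro hc
          apply hx
          apply Real.injOn_cos ⟨hxI.1.le, hxI.2⟩ ⟨by positivity, by linarith [Real.pi_pos]⟩
          rw [hc, Real.cos_pi_div_two]
        have h1 := Real.sin_sq_add_cos_sq x
        have h2 : 0 < Real.cos x ^ 2 := by positivity
        rw [← sq_lt_one_iff_abs_lt_one]
        linarith
      have := tendsto_pow_atTop_nhds_zero_of_lt_one (sq_nonneg (Real.sin x))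
        ((sq_lt_one_iff_abs_lt_one _).2 hlt)
      simpa [pow_mul] using this
  simpa using key

lemma integral_cos_pow_even_le {n : ℕ} {R η : ℝ} (α : ℝ) (hR : 0 ≤ R) (hη : 1 ≤ η) :
    ∫ v in (-R)..R, Real.cos (Real.pi * η * v + α) ^ (2 * n)
      ≤ (2 * R + 1) * ∫ x in (0 : ℝ)..Real.pi, Real.sin x ^ (2 * n) := by
  have hη0 : 0 < η := by linarith
  have hpi := Real.pi_pos
  have hc : Real.pi * η ≠ 0 := by positivity
  set J := ∫ x in (0 : ℝ)..Real.pi, Real.sin x ^ (2 * n) with hJ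
  have hJ0 : 0 ≤ J := intervalIntegral.integral_nonneg hpi.le fun x _ => by
    rw [pow_mul]; positivity
  set F : ℝ → ℝ := fun x => Real.sin x ^ (2 * n) with hF
  have hFc : Continuous F := by fun_prop
  have hFnn : ∀ x, 0 ≤ F x := fun x => by simp only [hF, pow_mul]; positivity
  have hper : Function.Periodic F Real.pi := fun x => by
    simp [hF, pow_mul, Real.sin_add_pi]
  have e1 : ∫ v in (-R)..R, Real.cos (Real.pi * η * v + α) ^ (2 * n)
      = ∫ v in (-R)..R, F (Real.pi * η * v + (α + Real.pi / 2)) := by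
    simp only [hF, ← add_assoc, Real.sin_add_pi_div_two]
  rw [e1, intervalIntegral.integral_comp_mul_add F hc]
  set a := Real.pi * η * -R + (α + Real.pi / 2) with ha
  set k := ⌈2 * R * η⌉₊ with hk
  have hk1 : 2 * R * η ≤ k := Nat.le_ceil _
  have hk2 : (k : ℝ) < 2 * R * η + 1 := Nat.ceil_lt_add_one (by positivity)
  have e2 : ∫ x in a..(a + (k : ℤ) • Real.pi), F x = k * J := by
    rw [hper.intervalIntegral_add_zsmul_eq (k : ℤ) a (fun _ _ => hFc.intervalIntegrable _ _),
      hper.intervalIntegral_add_eq a 0]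
    simp [hJ, hF]
  have e3 : ∫ x in a..(Real.pi * η * R + (α + Real.pi / 2)), F x ≤ k * J := by
    rw [← e2]
    refine intervalIntegral.integral_mono_interval le_rfl ?_ ?_
      (Filter.Eventually.of_forall hFnn) (hFc.intervalIntegrable _ _)
    · have : 0 ≤ Real.pi * η * R := by positivity
      rw [ha]; linarith
    · simp only [zsmul_eq_mul, Int.cast_natCast, ha]
      nlinarith
  rw [smul_eq_mul, inv_mul_le_iff₀ (by positivity)]
  refine e3.trans ?_
  have : (k : ℝ) ≤ Real.pi * η * (2 * R + 1) := by
    have h3 : 1 ≤ Real.pi := by linarith [Real.pi_gt_three]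
    have h4 : η * (2 * R + 1) ≤ Real.pi * (η * (2 * R + 1)) :=
      le_mul_of_one_le_left (by positivity) h3
    nlinarith
  calc (k : ℝ) * J ≤ Real.pi * η * (2 * R + 1) * J := by gcongr
    _ = _ := by ring

lemma integral_cos_pow_even_le_abs {n : ℕ} {R η : ℝ} (α : ℝ) (hR : 0 ≤ R) (hη : 1 ≤ |η|) :
    ∫ v in (-R)..R, Real.cos (Real.pi * η * v + α) ^ (2 * n)
      ≤ (2 * R + 1) * ∫ x in (0 : ℝ)..Real.pi, Real.sin x ^ (2 * n) := by
  rcases le_abs'.1 hη with h | h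
  · have e : ∀ v, Real.cos (Real.pi * η * v + α) = Real.cos (Real.pi * (-η) * v + (-α)) := by
      intro v
      rw [← Real.cos_neg]; congr 1; ring
    simp only [e]
    exact integral_cos_pow_even_le _ hR (by linarith)
  · exact integral_cos_pow_even_le _ hR h

/-- Nonnegative densities of mass `m` whose energy and entropy are at most `Cb`. -/
structure IsBoundedDensity (m Cb : ℝ) (h : ℝ → ℝ) : Prop where
  nonneg : ∀ v, 0 ≤ h v
  integrable : Integrable h
  mass : ∫ v, h v = m
  integrable_sq : Integrable fun v => v ^ 2 * h v
  energy_le : ∫ v, v ^ 2 * h v ≤ Cb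
  integrable_log : Integrable fun v => h v * Real.log (1 + h v)
  log_le : ∫ v, h v * Real.log (1 + h v) ≤ Cb

lemma IsBoundedDensity.integrable_mul {m Cb : ℝ} {h : ℝ → ℝ} (hh : IsBoundedDensity m Cb h)
    {F : ℝ → ℝ} (hF : Continuous F) {C : ℝ} (hC : ∀ v, |F v| ≤ C) :
    Integrable fun v => h v * F v :=
  hh.integrable.mul_bdd hF.aestronglyMeasurable (Filter.Eventually.of_forall hC)

lemma exists_integral_mul_sin_sq_ge {m Cb : ℝ} (hm : 0 < m) :
    ∃ δ : ℝ, 0 < δ ∧ δ ≤ 1 / 4 ∧ ∀ h : ℝ → ℝ, IsBoundedDensity m Cb h → ∀ η α : ℝ, 1 ≤ |η| →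
      m * δ ≤ ∫ v, h v * Real.sin (Real.pi * η * v + α) ^ 2 := by
  set C := |Cb| with hC
  have hC0 : 0 ≤ C := abs_nonneg _
  obtain ⟨R, hR0, hR⟩ : ∃ R : ℝ, 0 < R ∧ C / R ^ 2 ≤ m / 4 := by
    refine ⟨4 * C / m + 1, by positivity, ?_⟩
    have h1 : 1 ≤ 4 * C / m + 1 := by
      have : 0 ≤ 4 * C / m := by positivity
      linarith
    rw [div_le_iff₀ (by positivity)]
    have h2 : 4 * C / m + 1 ≤ (4 * C / m + 1) ^ 2 := by nlinarith
    have h3 : m / 4 * (4 * C / m + 1) = C + m / 4 := by field_simp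
    nlinarith
  obtain ⟨lam, hl0, hl⟩ : ∃ lam : ℝ, 0 < lam ∧ C / Real.log (1 + lam) ≤ m / 4 := by
    refine ⟨Real.exp (4 * C / m + 1) - 1, ?_, ?_⟩
    · have : 0 < 4 * C / m + 1 := by positivity
      linarith [Real.add_one_lt_exp this.ne']
    · rw [add_sub_cancel, Real.log_exp, div_le_iff₀ (by positivity)]
      have h3 : m / 4 * (4 * C / m + 1) = C + m / 4 := by field_simp
      linarith
  have hlog : 0 < Real.log (1 + lam) := Real.log_pos (by linarith)
  obtain ⟨n, hn1, hn⟩ : ∃ n : ℕ, 1 ≤ n ∧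
      lam * ((2 * R + 1) * ∫ x in (0 : ℝ)..Real.pi, Real.sin x ^ (2 * n)) ≤ m / 4 := by
    have := (tendsto_integral_sin_pow_even.const_mul (2 * R + 1)).const_mul lam
    simp only [mul_zero] at this
    have h1 := (this.eventually_le_const (by positivity : (0 : ℝ) < m / 4)).and
      (Filter.eventually_ge_atTop 1)
    obtain ⟨n, h2, h3⟩ := h1.exists
    exact ⟨n, h3, h2⟩
  have hn1' : (1 : ℝ) ≤ n := by exact_mod_cast hn1
  refine ⟨1 / (4 * n), by positivity, by
    rw [div_le_div_iff₀ (by positivity) (by norm_num)]; linarith, fun h hh η α hη => ?_⟩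
  set c : ℝ → ℝ := fun v => Real.cos (Real.pi * η * v + α) ^ (2 * n) with hc
  have hcc : Continuous c := by fun_prop
  have hc0 : ∀ v, 0 ≤ c v := fun v => by simp only [hc, pow_mul]; positivity
  have hc1 : ∀ v, c v ≤ 1 := fun v => by
    simp only [hc, pow_mul]
    exact pow_le_one₀ (sq_nonneg _) (Real.cos_sq_le_one _)
  have hind : Integrable fun v => Set.indicator (Set.Ioc (-R) R) (fun v => lam * c v) v := by
    rw [integrable_indicator_iff measurableSet_Ioc]
    exact ((by fun_prop : Continuous fun v => lam * c v).integrableOn_Icc).mono_set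
      Set.Ioc_subset_Icc_self
  have hlogn : ∀ v, 0 ≤ h v * Real.log (1 + h v) := fun v =>
    mul_nonneg (hh.nonneg v) (Real.log_nonneg (by linarith [hh.nonneg v]))
  have hpt : ∀ v, h v * c v ≤ v ^ 2 * h v / R ^ 2 + h v * Real.log (1 + h v) / Real.log (1 + lam)
      + Set.indicator (Set.Ioc (-R) R) (fun v => lam * c v) v := by
    intro v
    have p1 : 0 ≤ v ^ 2 * h v / R ^ 2 := by have := hh.nonneg v; positivity
    have p2 : 0 ≤ h v * Real.log (1 + h v) / Real.log (1 + lam) := div_nonneg (hlogn v) hlog.le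
    have p3 : 0 ≤ Set.indicator (Set.Ioc (-R) R) (fun v => lam * c v) v :=
      Set.indicator_nonneg (fun x _ => mul_nonneg hl0.le (hc0 x)) v
    have p4 : h v * c v ≤ h v := mul_le_of_le_one_right (hh.nonneg v) (hc1 v)
    by_cases hv : v ∈ Set.Ioc (-R) R
    · by_cases hvl : h v ≤ lam
      · rw [Set.indicator_of_mem hv] at p3 ⊢
        have : h v * c v ≤ lam * c v := mul_le_mul_of_nonneg_right hvl (hc0 v)
        linarith
      · push Not at hvl
        have : h v ≤ h v * Real.log (1 + h v) / Real.log (1 + lam) := by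
          rw [le_div_iff₀ hlog]
          exact mul_le_mul_of_nonneg_left (Real.log_le_log (by linarith) (by linarith))
            (hh.nonneg v)
        linarith
    · have hRv : R ^ 2 ≤ v ^ 2 := by
        by_contra hcon
        push Not at hcon
        have := abs_lt_of_sq_lt_sq hcon hR0.le
        exact hv ⟨(abs_lt.1 this).1, (abs_lt.1 this).2.le⟩
      have : h v ≤ v ^ 2 * h v / R ^ 2 := by
        rw [le_div_iff₀ (by positivity), mul_comm]
        exact mul_le_mul_of_nonneg_right hRv (hh.nonneg v)
      linarith
  have i1 := hh.integrable_sq.div_const (R ^ 2)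
  have i2 := hh.integrable_log.div_const (Real.log (1 + lam))
  have ic : Integrable fun v => h v * c v :=
    hh.integrable_mul hcc (C := 1) fun v => by rw [abs_of_nonneg (hc0 v)]; exact hc1 v
  have hle : ∫ v, h v * c v ≤ 3 * m / 4 := by
    have h1 := integral_mono ic ((i1.add i2).add hind) hpt
    simp only [Pi.add_apply] at h1
    rw [integral_add (by exact i1.add i2) hind, integral_add i1 i2, MeasureTheory.integral_div,
      MeasureTheory.integral_div,
      MeasureTheory.integral_indicator measurableSet_Ioc,
      ← intervalIntegral.integral_of_le (by linarith), intervalIntegral.integral_const_mul] at h1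
    have h2 : lam * ∫ v in (-R)..R, c v ≤ m / 4 :=
      (mul_le_mul_of_nonneg_left (integral_cos_pow_even_le_abs α hR0.le hη) hl0.le).trans hn
    have h3 : (∫ v, v ^ 2 * h v) / R ^ 2 ≤ C / R ^ 2 := by
      gcongr; exact hh.energy_le.trans (le_abs_self _)
    have h4 : (∫ v, h v * Real.log (1 + h v)) / Real.log (1 + lam) ≤ C / Real.log (1 + lam) := by
      gcongr; exact hh.log_le.trans (le_abs_self _)
    linarith
  have isin : Integrable fun v => h v * Real.sin (Real.pi * η * v + α) ^ 2 :=
    hh.integrable_mul (by fun_prop) (C := 1) fun v => by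
      rw [abs_of_nonneg (sq_nonneg _)]; exact Real.sin_sq_le_one _
  have hpt2 : ∀ v, h v - h v * c v ≤ n * (h v * Real.sin (Real.pi * η * v + α) ^ 2) := by
    intro v
    have hb := one_add_mul_le_pow (a := -Real.sin (Real.pi * η * v + α) ^ 2)
      (by linarith [Real.sin_sq_le_one (Real.pi * η * v + α)]) n
    have e : (1 + -Real.sin (Real.pi * η * v + α) ^ 2) ^ n = c v := by
      simp only [hc, pow_mul, Real.cos_sq']; ring
    rw [e] at hb
    nlinarith [hh.nonneg v]
  have h5 := integral_mono (hh.integrable.sub ic) (isin.const_mul (n : ℝ)) hpt2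
  simp only [Pi.sub_apply] at h5
  rw [integral_sub hh.integrable ic, hh.mass, MeasureTheory.integral_const_mul] at h5
  rw [mul_one_div, div_le_iff₀ (by positivity)]
  nlinarith

lemma FT_ofReal_eq_norm {h : ℝ → ℝ} (hi : Integrable h) (η : ℝ) :
    ∃ α : ℝ, ‖FT (fun v => (h v : ℂ)) η‖
      = ∫ v, h v * Real.cos (2 * (Real.pi * η * v + α)) := by
  set z := FT (fun v => (h v : ℂ)) η with hz
  refine ⟨z.arg / 2, ?_⟩
  have h1 : ((‖z‖ : ℝ) : ℂ) = Complex.exp (-(z.arg * Complex.I)) * z := by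
    conv_rhs => rw [← Complex.norm_mul_exp_arg_mul_I z]
    rw [mul_left_comm, ← Complex.exp_add]
    simp
  have h2 : ‖z‖ = (Complex.exp (-(z.arg * Complex.I)) * z).re := by rw [← h1, Complex.ofReal_re]
  have h_int : Integrable fun v : ℝ => Complex.exp (-(z.arg * Complex.I)) *
      (Complex.exp (-(2 * Real.pi * v * η) * Complex.I) * (h v : ℂ)) := by
    refine (Integrable.bdd_mul (c := 1) hi.ofReal ?_ ?_).const_mul _
    · exact (by fun_prop : Continuous fun v : ℝ =>
        Complex.exp (-(2 * Real.pi * v * η) * Complex.I)).aestronglyMeasurable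
    · refine Filter.Eventually.of_forall fun v => ?_
      have e : (-(2 * Real.pi * v * η) * Complex.I : ℂ)
        = ((-(2 * Real.pi * v * η) : ℝ) : ℂ) * Complex.I := by push_cast; ring
      rw [e, Complex.norm_exp_ofReal_mul_I]
  have h3 : Complex.exp (-(z.arg * Complex.I)) * z = ∫ v : ℝ, Complex.exp (-(z.arg * Complex.I)) *
      (Complex.exp (-(2 * Real.pi * v * η) * Complex.I) * (h v : ℂ)) := by
    rw [MeasureTheory.integral_const_mul, hz, FT]
  rw [h2, h3, ← RCLike.re_eq_complex_re, ← integral_re h_int]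
  congr 1
  ext v
  rw [← mul_assoc, ← Complex.exp_add, RCLike.re_eq_complex_re, Complex.re_mul_ofReal]
  have e : (-(z.arg * Complex.I) + -(2 * Real.pi * v * η) * Complex.I : ℂ)
        = ((-(2 * (Real.pi * η * v + z.arg / 2)) : ℝ) : ℂ) * Complex.I := by push_cast; ring
  rw [e, Complex.exp_ofReal_mul_I_re, Real.cos_neg, mul_comm]

lemma exists_norm_FT_le {m Cb : ℝ} (hm : 0 < m) :
    ∃ κ : ℝ, 0 < κ ∧ κ ≤ 1 ∧ ∀ h : ℝ → ℝ, IsBoundedDensity m Cb h → ∀ η : ℝ,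
      ‖FT (fun v => (h v : ℂ)) η‖ ≤ m * Real.exp (-(κ * min (η ^ 2) 1)) := by
  obtain ⟨δ, hδ0, hδ1, hδ⟩ := exists_integral_mul_sin_sq_ge (Cb := Cb) hm
  refine ⟨δ / 2, by positivity, by linarith, fun h hh η => ?_⟩
  obtain ⟨α, hα⟩ := FT_ofReal_eq_norm hh.integrable η
  have isin : ∀ η α : ℝ, Integrable fun v => h v * Real.sin (Real.pi * η * v + α) ^ 2 :=
    fun η α => hh.integrable_mul (by fun_prop) (C := 1) fun v => by
      rw [abs_of_nonneg (sq_nonneg _)]; exact Real.sin_sq_le_one _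
  have e1 : ‖FT (fun v => (h v : ℂ)) η‖
      = m - 2 * ∫ v, h v * Real.sin (Real.pi * η * v + α) ^ 2 := by
    rw [hα, ← hh.mass, ← MeasureTheory.integral_const_mul, ← integral_sub hh.integrable ((isin η α).const_mul 2)]
    congr 1
    ext v
    rw [Real.cos_two_mul, Real.cos_sq']
    ring
  have hD : m * δ * (min (η ^ 2) 1 / 4) ≤ ∫ v, h v * Real.sin (Real.pi * η * v + α) ^ 2 := by
    rcases le_or_gt 1 |η| with h1 | h1
    · have h2 := hδ h hh η α h1
      have h3 : min (η ^ 2) 1 ≤ 1 := min_le_right _ _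
      have h4 : 0 < m * δ := by positivity
      nlinarith
    · rcases eq_or_ne η 0 with rfl | h0
      · simp only [ne_eq, OfNat.ofNat_ne_zero, not_false_eq_true, zero_pow, zero_le_one, inf_of_le_left,
          zero_div, mul_zero]
        exact integral_nonneg fun v => mul_nonneg (hh.nonneg v) (sq_nonneg _)
      · have hη0 : 0 < |η| := abs_pos.2 h0
        set k := ⌈1 / |η|⌉₊ with hk
        have hk1 : 1 / |η| ≤ k := Nat.le_ceil _
        have hk2 : (k : ℝ) < 1 / |η| + 1 := Nat.ceil_lt_add_one (by positivity)
        have hk3 : 1 ≤ k * |η| := by rwa [div_le_iff₀ hη0] at hk1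
        have hk4 : k * |η| ≤ 2 := by
          have : k * |η| < (1 / |η| + 1) * |η| := by gcongr
          rw [add_mul, div_mul_cancel₀ _ hη0.ne'] at this
          linarith
        have h2 := hδ h hh (k * η) (k * α) (by rwa [abs_mul, Nat.abs_cast])
        have h3 : ∫ v, h v * Real.sin (Real.pi * (k * η) * v + k * α) ^ 2
            ≤ ∫ v, k ^ 2 * (h v * Real.sin (Real.pi * η * v + α) ^ 2) := by
          refine integral_mono (isin _ _) ((isin _ _).const_mul _) fun v => ?_
          have h4 := abs_sin_nat_mul_le k (Real.pi * η * v + α)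
          have h5 : Real.sin (k * (Real.pi * η * v + α)) ^ 2
              ≤ (k * |Real.sin (Real.pi * η * v + α)|) ^ 2 := by
            rw [← sq_abs]; gcongr
          rw [mul_pow, sq_abs] at h5
          have e : Real.pi * (k * η) * v + k * α = k * (Real.pi * η * v + α) := by ring
          rw [e]
          have := mul_le_mul_of_nonneg_left h5 (hh.nonneg v)
          simp only at this ⊢
          linarith
        rw [MeasureTheory.integral_const_mul] at h3
        set D := ∫ v, h v * Real.sin (Real.pi * η * v + α) ^ 2 with hDdef
        have hD0 : 0 ≤ D := integral_nonneg fun v => mul_nonneg (hh.nonneg v) (sq_nonneg _)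
        have h6 : min (η ^ 2) 1 ≤ η ^ 2 := min_le_left _ _
        have h7 : (k : ℝ) ^ 2 * η ^ 2 ≤ 4 := by
          have : (k * |η|) ^ 2 ≤ 2 ^ 2 := by gcongr
          rw [mul_pow, sq_abs] at this
          linarith
        have h8 : m * δ * η ^ 2 ≤ k ^ 2 * D * η ^ 2 :=
          mul_le_mul_of_nonneg_right (by linarith) (sq_nonneg _)
        have h9 : k ^ 2 * D * η ^ 2 ≤ 4 * D := by nlinarith
        have h10 : m * δ * min (η ^ 2) 1 ≤ m * δ * η ^ 2 := by gcongr
        linarith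
  rw [e1]
  have h3 := Real.add_one_le_exp (-(δ / 2 * min (η ^ 2) 1))
  nlinarith

/-! ### The Kac cross-section -/

lemma kacBeta_nonneg {C₀ : ℝ} (hC₀ : 0 ≤ C₀) (s θ : ℝ) : 0 ≤ kacBeta C₀ s θ := by
  unfold kacBeta; positivity

lemma measurable_kacBeta (C₀ s : ℝ) : Measurable (kacBeta C₀ s) := by
  unfold kacBeta; fun_prop

lemma kacBeta_mul_sin_sq_ge {C₀ s r θ : ℝ} (hC₀ : 0 ≤ C₀) (hs0 : 0 < s) (hs : s < 1 / 2)
    (hr : 1 ≤ r) (hθ : θ ∈ Set.Icc (1 / (2 * r)) (1 / r)) :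
    C₀ / 8 * r ^ (2 * s) * r ≤ kacBeta C₀ s θ * (r ^ 2 * Real.sin θ ^ 2) := by
  have hr0 : 0 < r := by linarith
  have h1r : 1 / r ≤ 1 := by rw [div_le_one hr0]; exact hr
  have hθ0 : 0 < θ := lt_of_lt_of_le (by positivity) hθ.1
  have hθ1 : θ ≤ 1 := hθ.2.trans h1r
  have hpi := Real.pi_gt_three
  have hcos : 1 / 2 ≤ Real.cos θ := by
    have := Real.one_sub_sq_div_two_le_cos (x := θ)
    nlinarith
  have hsin : 1 / (4 * r) ≤ Real.sin θ := by
    have h1 := Real.mul_le_sin hθ0.le (by linarith)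
    have h2 : (1 : ℝ) / 2 ≤ 2 / Real.pi := by
      rw [div_le_div_iff₀ (by norm_num) (by linarith)]; linarith [Real.pi_le_four]
    have h3 : 1 / (4 * r) = 1 / 2 * (1 / (2 * r)) := by field_simp; norm_num
    rw [h3]
    exact (mul_le_mul h2 hθ.1 (by positivity) (by positivity)).trans h1
  have hsin0 : 0 < Real.sin θ := lt_of_lt_of_le (by positivity) hsin
  have e1 : kacBeta C₀ s θ * (r ^ 2 * Real.sin θ ^ 2)
      = C₀ * Real.cos θ * r ^ 2 * Real.sin θ ^ (1 - 2 * s) := by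
    have : Real.sin θ ^ (1 - 2 * s) = Real.sin θ ^ 2 / Real.sin θ ^ (1 + 2 * s) := by
      rw [← Real.rpow_natCast, ← Real.rpow_sub hsin0]; norm_num; ring_nf
    rw [kacBeta, abs_of_pos hsin0, abs_of_pos (by linarith), this]
    ring
  have h4 : r ^ (2 * s - 1) / 4 ≤ Real.sin θ ^ (1 - 2 * s) := by
    have h5 : (1 / (4 * r)) ^ (1 - 2 * s) ≤ Real.sin θ ^ (1 - 2 * s) :=
      Real.rpow_le_rpow (by positivity) hsin (by linarith)
    refine le_trans ?_ h5
    have h6 : (1 / (4 * r)) ^ (1 - 2 * s) = (1 / 4) ^ (1 - 2 * s) * r ^ (2 * s - 1) := by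
      rw [show 1 / (4 * r) = 1 / 4 * r⁻¹ by field_simp, Real.mul_rpow (by norm_num) (by positivity),
        Real.inv_rpow hr0.le, ← Real.rpow_neg hr0.le]
      congr 2; ring
    have h7 : ((1 : ℝ) / 4) ^ (1 : ℝ) ≤ (1 / 4) ^ (1 - 2 * s) :=
      Real.rpow_le_rpow_of_exponent_ge (by norm_num) (by norm_num) (by linarith)
    rw [Real.rpow_one] at h7
    rw [h6, div_eq_inv_mul, ← one_div]
    gcongr
  have h8 : r ^ (2 * s) * r = r ^ 2 * r ^ (2 * s - 1) := by
    rw [Real.rpow_sub_one hr0.ne']; field_simp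
  rw [e1, mul_assoc (C₀ / 8), h8]
  calc C₀ / 8 * (r ^ 2 * r ^ (2 * s - 1)) = C₀ * (1 / 2) * r ^ 2 * (r ^ (2 * s - 1) / 4) := by ring
    _ ≤ _ := by gcongr

lemma integral_le_of_le_kacBeta {C₀ s r A : ℝ} (hC₀ : 0 ≤ C₀) (hs0 : 0 < s) (hs : s < 1 / 2)
    (hr : 1 ≤ r) (hA : 0 ≤ A) {N : ℝ → ℝ}
    (hN : IntervalIntegrable N volume (-(Real.pi / 2)) (Real.pi / 2)) (hN0 : ∀ θ, N θ ≤ 0)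
    (hNA : ∀ θ ∈ Set.Icc (1 / (2 * r)) (1 / r),
      N θ ≤ -(A * (kacBeta C₀ s θ * (r ^ 2 * Real.sin θ ^ 2)))) :
    ∫ θ in (-(Real.pi / 2))..(Real.pi / 2), N θ ≤ -(A * C₀ / 16 * r ^ (2 * s)) := by
  have hr0 : 0 < r := by linarith
  have h1r : 1 / r ≤ 1 := by rw [div_le_one hr0]; exact hr
  have hpi := Real.pi_gt_three
  have hpos : 0 < 1 / (2 * r) := by positivity
  have hab : 1 / (2 * r) ≤ 1 / r := by gcongr; linarith
  have h1 : ∫ θ in (1 / (2 * r))..(1 / r), -N θ ≤ ∫ θ in (-(Real.pi / 2))..(Real.pi / 2), -N θ :=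
    intervalIntegral.integral_mono_interval (by linarith) hab (by linarith)
      (Filter.Eventually.of_forall fun θ => by simpa using hN0 θ) hN.neg
  have h2 : ∫ _θ in (1 / (2 * r))..(1 / r), A * (C₀ / 8 * r ^ (2 * s) * r)
      ≤ ∫ θ in (1 / (2 * r))..(1 / r), -N θ := by
    refine intervalIntegral.integral_mono_on hab (by simp) ?_ fun θ hθ => ?_
    · refine (hN.mono_set ?_).neg
      rw [Set.uIcc_of_le hab, Set.uIcc_of_le (by linarith)]
      exact Set.Icc_subset_Icc (by linarith) (by linarith)
    · have := hNA θ hθ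
      have := mul_le_mul_of_nonneg_left (kacBeta_mul_sin_sq_ge hC₀ hs0 hs hr hθ) hA
      linarith
  rw [intervalIntegral.integral_const, smul_eq_mul] at h2
  have h3 : (1 / r - 1 / (2 * r)) * (A * (C₀ / 8 * r ^ (2 * s) * r)) = A * C₀ / 16 * r ^ (2 * s) := by
    field_simp; ring
  rw [intervalIntegral.integral_neg] at h2
  rw [intervalIntegral.integral_neg, intervalIntegral.integral_neg] at h1
  linarith

lemma intervalIntegrable_kacBeta_mul_sin {C₀ s : ℝ} (hC₀ : 0 ≤ C₀) (hs0 : 0 < s) (hs : s < 1 / 2) :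
    IntervalIntegrable (fun θ => kacBeta C₀ s θ * |Real.sin θ|) volume
      (-(Real.pi / 2)) (Real.pi / 2) := by
  have hpi := Real.pi_pos
  have h1 : IntervalIntegrable (fun θ : ℝ => |θ| ^ (-(2 * s))) volume
      (-(Real.pi / 2)) (Real.pi / 2) := by
    have h0 : IntervalIntegrable (fun θ : ℝ => |θ| ^ (-(2 * s))) volume 0 (Real.pi / 2) := by
      refine (intervalIntegral.intervalIntegrable_rpow' (r := -(2 * s)) (by linarith)).congr ?_
      intro θ hθ
      rw [Set.uIoc_of_le (by positivity)] at hθ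
      simp only [abs_of_pos hθ.1]
    have h2 := (IntervalIntegrable.iff_comp_neg).1 h0
    simp only [abs_neg, neg_zero] at h2
    exact h2.symm.trans h0
  refine (h1.const_mul (C₀ * (2 / Real.pi) ^ (-(2 * s)))).mono_fun ?_ ?_
  · exact ((measurable_kacBeta C₀ s).mul (by fun_prop)).aestronglyMeasurable
  · rw [Set.uIoc_of_le (by linarith)]
    refine (ae_restrict_iff' measurableSet_Ioc).2 (Filter.Eventually.of_forall fun θ hθ => ?_)
    have hβ := kacBeta_nonneg hC₀ s θ
    beta_reduce
    rw [Real.norm_of_nonneg (by positivity), Real.norm_of_nonneg (by positivity)]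
    rcases eq_or_ne θ 0 with rfl | h0
    · simp only [Real.sin_zero, abs_zero, mul_zero]; positivity
    · have hθ' : |θ| ≤ Real.pi / 2 := abs_le.2 ⟨hθ.1.le, hθ.2⟩
      have h3 := Real.mul_abs_le_abs_sin hθ'
      have h4 : 0 < 2 / Real.pi * |θ| := by positivity
      have h5 : 0 < |Real.sin θ| := by linarith
      have e : kacBeta C₀ s θ * |Real.sin θ| = C₀ * |Real.cos θ| * |Real.sin θ| ^ (-(2 * s)) := by
        rw [kacBeta, Real.rpow_add h5, Real.rpow_one, Real.rpow_neg h5.le]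
        field_simp
      have h6 : |Real.sin θ| ^ (-(2 * s)) ≤ (2 / Real.pi * |θ|) ^ (-(2 * s)) :=
        Real.rpow_le_rpow_of_nonpos h4 h3 (by linarith)
      rw [Real.mul_rpow (by positivity) (by positivity)] at h6
      rw [e]
      calc C₀ * |Real.cos θ| * |Real.sin θ| ^ (-(2 * s))
          ≤ C₀ * 1 * ((2 / Real.pi) ^ (-(2 * s)) * |θ| ^ (-(2 * s))) := by
            gcongr; exact Real.abs_cos_le_one θ
        _ = _ := by ring

/-! ### The barrier argument on the Fourier side -/

lemma mul_rpow_sub_one_le {p σ x : ℝ} (hp0 : 0 ≤ p) (hp1 : p ≤ 1) (hσ0 : 0 ≤ σ) (hσ1 : σ ≤ 1)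
    (hx : 0 ≤ x) : σ * ((1 + x) ^ p - 1) ≤ (1 + σ * x) ^ p - 1 := by
  have h := (Real.concaveOn_rpow hp0 hp1).2 (x := 1 + x) (y := 1) (by simp; linarith) (by simp)
    hσ0 (sub_nonneg.2 hσ1) (by ring)
  simp only [smul_eq_mul, Real.one_rpow] at h
  rw [show σ * (1 + x) + (1 - σ) * 1 = 1 + σ * x by ring] at h
  linarith

/-- The exponent `c t ((1 + ξ²)^p - 1) - ε ξ²` of the barrier. -/
def barrierExponent (c ε p t ξ : ℝ) : ℝ := c * t * ((1 + ξ ^ 2) ^ p - 1) - ε * ξ ^ 2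

lemma continuous_barrierExponent {c ε p : ℝ} :
    Continuous (Function.uncurry (barrierExponent c ε p)) := by
  unfold barrierExponent Function.uncurry
  have : Continuous fun z : ℝ × ℝ => (1 + z.2 ^ 2) ^ p :=
    (by fun_prop : Continuous fun z : ℝ × ℝ => 1 + z.2 ^ 2).rpow_const
      fun z => Or.inl (by positivity)
  fun_prop

lemma mul_barrierExponent_le {c ε p t ξ ζ σ : ℝ} (hc : 0 ≤ c) (ht : 0 ≤ t) (hp0 : 0 ≤ p)
    (hp1 : p ≤ 1) (hσ0 : 0 ≤ σ) (hσ1 : σ ≤ 1) (hζ : ζ ^ 2 = σ * ξ ^ 2) :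
    σ * barrierExponent c ε p t ξ ≤ barrierExponent c ε p t ζ := by
  have := mul_le_mul_of_nonneg_left (mul_rpow_sub_one_le hp0 hp1 hσ0 hσ1 (sq_nonneg ξ))
    (mul_nonneg hc ht)
  unfold barrierExponent
  rw [hζ]
  linarith

lemma barrierExponent_le {c ε p t ξ : ℝ} (hc : 0 ≤ c) (ht : 0 ≤ t) (hε : 0 ≤ ε) (hp1 : p ≤ 1) :
    barrierExponent c ε p t ξ ≤ c * t * ξ ^ 2 := by
  have h1 : (1 + ξ ^ 2) ^ p ≤ 1 + ξ ^ 2 :=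
    Real.rpow_le_self_of_one_le (by nlinarith) hp1
  have h2 := mul_le_mul_of_nonneg_left (sub_le_sub_right h1 1) (mul_nonneg hc ht)
  have h3 : 0 ≤ ε * ξ ^ 2 := by positivity
  unfold barrierExponent
  linarith

lemma rpow_sub_one_le_abs_rpow {p ξ : ℝ} (hp0 : 0 ≤ p) (hp1 : p ≤ 1) :
    (1 + ξ ^ 2) ^ p - 1 ≤ |ξ| ^ (2 * p) := by
  have h1 := Real.rpow_add_le_add_rpow (p := p) zero_le_one (sq_nonneg ξ) hp0 hp1
  rw [Real.one_rpow, ← sq_abs, ← Real.rpow_natCast, ← Real.rpow_mul (abs_nonneg _)] at h1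
  rw [← sq_abs, ← Real.rpow_natCast]
  push_cast at h1 ⊢
  linarith

/-- The integrand of the Kac collision operator on the Fourier side. -/
def kacFourierIntegrand (C₀ s m : ℝ) (u : ℝ → ℂ) (ξ θ : ℝ) : ℂ :=
  (kacBeta C₀ s θ : ℂ) * (u (ξ * Real.cos θ) * u (-(ξ * Real.sin θ)) - m * u ξ)

lemma re_integral_kacFourierIntegrand_le {C₀ s m κ c ε p t : ℝ} (hC₀ : 0 < C₀) (hs0 : 0 < s)
    (hs : s < 1 / 2) (hm : 0 < m) (hκ0 : 0 < κ) (hκ1 : κ ≤ 1) (hp0 : 0 ≤ p) (hp1 : p ≤ 1)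
    (hc : 0 ≤ c) (ht : 0 ≤ t) (hε : 0 ≤ ε) (hct : c * t ≤ κ / 2) {u : ℝ → ℂ}
    (hcoer : ∀ ξ, ‖u ξ‖ ≤ m * Real.exp (-(κ * min (ξ ^ 2) 1)))
    (hbar : ∀ ξ, ‖u ξ‖ ≤ m * Real.exp (-barrierExponent c ε p t ξ)) {ξ : ℝ} (hξ : 1 ≤ |ξ|)
    (h_int : IntervalIntegrable (kacFourierIntegrand C₀ s m u ξ) volume
      (-(Real.pi / 2)) (Real.pi / 2))
    (heq : ‖u ξ‖ = m * Real.exp (-barrierExponent c ε p t ξ)) :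
    inner ℝ (u ξ) (∫ θ in (-(Real.pi / 2))..(Real.pi / 2), kacFourierIntegrand C₀ s m u ξ θ)
      ≤ -(‖u ξ‖ ^ 2 * (m * κ * C₀ / 64) * |ξ| ^ (2 * s)) := by
  set B := ‖u ξ‖ with hB
  set Φ := barrierExponent c ε p t ξ with hΦ
  have hB0 : 0 < B := by rw [heq]; positivity
  set N : ℝ → ℝ := fun θ => inner ℝ (u ξ) (kacFourierIntegrand C₀ s m u ξ θ) with hN
  have eN : inner ℝ (u ξ) (∫ θ in (-(Real.pi / 2))..(Real.pi / 2), kacFourierIntegrand C₀ s m u ξ θ)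
      = ∫ θ in (-(Real.pi / 2))..(Real.pi / 2), N θ :=
    ((innerSL ℝ (u ξ)).intervalIntegral_comp_comm h_int).symm
  have hNi : IntervalIntegrable N volume (-(Real.pi / 2)) (Real.pi / 2) :=
    ⟨(innerSL ℝ (u ξ)).integrable_comp h_int.1, (innerSL ℝ (u ξ)).integrable_comp h_int.2⟩
  have hNle : ∀ θ, N θ ≤ kacBeta C₀ s θ *
      (B * (‖u (ξ * Real.cos θ)‖ * ‖u (-(ξ * Real.sin θ))‖) - m * B ^ 2) := by
    intro θ
    have e : N θ = kacBeta C₀ s θ *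
        (inner ℝ (u ξ) (u (ξ * Real.cos θ) * u (-(ξ * Real.sin θ))) - m * B ^ 2) := by
      have h1 : kacFourierIntegrand C₀ s m u ξ θ = kacBeta C₀ s θ •
        (u (ξ * Real.cos θ) * u (-(ξ * Real.sin θ)) - m • u ξ) := by
        simp [kacFourierIntegrand]
      simp only [hN]
      rw [h1, real_inner_smul_right, inner_sub_right, real_inner_smul_right,
        real_inner_self_eq_norm_sq]
    rw [e]
    refine mul_le_mul_of_nonneg_left ?_ (kacBeta_nonneg hC₀.le s θ)
    have := real_inner_le_norm (u ξ) (u (ξ * Real.cos θ) * u (-(ξ * Real.sin θ)))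
    rw [norm_mul] at this
    linarith
  have hcosb : ∀ θ, ‖u (ξ * Real.cos θ)‖ ≤ m * Real.exp (-((1 - Real.sin θ ^ 2) * Φ)) := by
    intro θ
    refine (hbar _).trans ?_
    have := mul_barrierExponent_le (ε := ε) (ξ := ξ) (ζ := ξ * Real.cos θ) (σ := 1 - Real.sin θ ^ 2)
      hc ht hp0 hp1 (by linarith [Real.sin_sq_le_one θ]) (by linarith [sq_nonneg (Real.sin θ)])
      (by rw [mul_pow, Real.cos_sq']; ring)
    gcongr
  have hsinb : ∀ θ, ‖u (-(ξ * Real.sin θ))‖ ≤ m * Real.exp (-(Real.sin θ ^ 2 * Φ)) := by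
    intro θ
    refine (hbar _).trans ?_
    have := mul_barrierExponent_le (ε := ε) (ξ := ξ) (ζ := -(ξ * Real.sin θ)) (σ := Real.sin θ ^ 2)
      hc ht hp0 hp1 (sq_nonneg _) (Real.sin_sq_le_one θ) (by ring)
    gcongr
  have hprod : ∀ θ y, ‖u (-(ξ * Real.sin θ))‖ ≤ m * Real.exp (-(Real.sin θ ^ 2 * Φ) - y) →
      N θ ≤ -(kacBeta C₀ s θ * (m * B ^ 2 * (1 - Real.exp (-y)))) := by
    intro θ y hy
    refine (hNle θ).trans ?_
    have h1 : ‖u (ξ * Real.cos θ)‖ * ‖u (-(ξ * Real.sin θ))‖ ≤ m * B * Real.exp (-y) := by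
      refine (mul_le_mul (hcosb θ) hy (norm_nonneg _) (by positivity)).trans (le_of_eq ?_)
      rw [heq, mul_mul_mul_comm, ← Real.exp_add, mul_assoc m, mul_assoc m, mul_assoc m,
        ← Real.exp_add]
      ring_nf
    have h2 := mul_le_mul_of_nonneg_left h1 hB0.le
    rw [← mul_neg (kacBeta C₀ s θ)]
    refine mul_le_mul_of_nonneg_left ?_ (kacBeta_nonneg hC₀.le s θ)
    linarith
  have hfin := integral_le_of_le_kacBeta (A := B ^ 2 * (m * κ / 4)) hC₀.le hs0 hs hξ (by positivity) hNi
    (fun θ => by simpa using hprod θ 0 (by simpa using hsinb θ)) (fun θ hθ => ?_)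
  · rw [eN]
    refine hfin.trans (le_of_eq ?_)
    ring
  · have hr0 : 0 < |ξ| := by linarith
    have hθ0 : 0 < θ := lt_of_lt_of_le (by positivity) hθ.1
    set x := |ξ| ^ 2 * Real.sin θ ^ 2 with hx
    have hx0 : 0 ≤ x := by positivity
    have hxe : (-(ξ * Real.sin θ)) ^ 2 = x := by rw [hx, sq_abs]; ring
    have hx1 : x ≤ 1 := by
      have h1 : |Real.sin θ| ≤ 1 / |ξ| := by
        calc |Real.sin θ| ≤ |θ| := Real.abs_sin_le_abs
          _ = θ := abs_of_pos hθ0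
          _ ≤ _ := hθ.2
      have h2 : |ξ| * |Real.sin θ| ≤ 1 := by rwa [le_div_iff₀' hr0] at h1
      rw [hx, ← mul_pow, ← sq_abs, abs_mul, abs_abs]
      exact pow_le_one₀ (by positivity) h2
    have hy : ‖u (-(ξ * Real.sin θ))‖ ≤ m * Real.exp (-(Real.sin θ ^ 2 * Φ) - κ * x / 2) := by
      refine (hcoer _).trans ?_
      rw [hxe, min_eq_left hx1]
      have h3 : Φ ≤ κ / 2 * ξ ^ 2 :=
        (barrierExponent_le hc ht hε hp1).trans (by gcongr)
      have h4 : Real.sin θ ^ 2 * Φ ≤ κ / 2 * x := by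
        have := mul_le_mul_of_nonneg_left h3 (sq_nonneg (Real.sin θ))
        rw [hx, sq_abs]; linarith
      gcongr
      linarith
    refine (hprod θ _ hy).trans ?_
    have hy0 : 0 ≤ κ * x / 2 := by positivity
    have hy1 : κ * x / 2 ≤ 1 := by nlinarith
    have h5 : κ * x / 4 ≤ 1 - Real.exp (-(κ * x / 2)) := by
      have h7 : Real.exp (-(κ * x / 2)) ≤ 1 / (1 + κ * x / 2) := by
        rw [Real.exp_neg, ← one_div]
        gcongr
        linarith [Real.add_one_le_exp (κ * x / 2)]
      have h8 : 1 / (1 + κ * x / 2) ≤ 1 - κ * x / 4 := by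
        rw [div_le_iff₀ (by positivity)]
        nlinarith
      linarith
    have h9 := mul_le_mul_of_nonneg_left h5
      (mul_nonneg (kacBeta_nonneg hC₀.le s θ) (by positivity : 0 ≤ m * B ^ 2))
    linarith

lemma nonneg_of_hasDerivWithinAt_Iic {h : ℝ → ℝ} {d t : ℝ} (ht : 0 < t)
    (hd : HasDerivWithinAt h d (Set.Iic t) t) (hle : ∀ τ, 0 ≤ τ → τ < t → h τ ≤ h t) : 0 ≤ d := by
  have h1 := (hasDerivWithinAt_iff_tendsto_slope' (by simp)).1 hd.Iio_of_Iic
  refine ge_of_tendsto h1 ?_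
  filter_upwards [Ioo_mem_nhdsLT ht] with τ hτ
  rw [slope_def_field]
  exact div_nonneg_of_nonpos (sub_nonpos.2 (hle τ hτ.1.le hτ.2)) (by linarith [hτ.2])

lemma norm_le_exp_neg_barrierExponent {C₀ s m κ c ε p T : ℝ} (hC₀ : 0 < C₀) (hs0 : 0 < s)
    (hs : s < 1 / 2) (hm : 0 < m) (hκ0 : 0 < κ) (hκ1 : κ ≤ 1) (hp0 : 0 < p) (hp1 : p < s)
    (hc : 0 ≤ c) (hε : 0 < ε) (hcT : c * T ≤ κ / 2) (hcm : c < m * κ * C₀ / 64) {g : ℝ → ℝ → ℂ}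
    (hg : Continuous (Function.uncurry g))
    (hcoer : ∀ t ξ, ‖g t ξ‖ ≤ m * Real.exp (-(κ * min (ξ ^ 2) 1)))
    (h_int : ∀ t ξ, IntervalIntegrable (kacFourierIntegrand C₀ s m (g t) ξ) volume
      (-(Real.pi / 2)) (Real.pi / 2))
    (hder : ∀ t ∈ Set.Ioc 0 T, ∀ ξ, HasDerivWithinAt (fun τ => g τ ξ)
      (∫ θ in (-(Real.pi / 2))..(Real.pi / 2), kacFourierIntegrand C₀ s m (g t) ξ θ)
      (Set.Iic t) t) :
    ∀ t ∈ Set.Icc 0 T, ∀ ξ, ‖g t ξ‖ ≤ m * Real.exp (-barrierExponent c ε p t ξ) := by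
  have hp1' : p ≤ 1 := by linarith
  have hgm : ∀ t ξ, ‖g t ξ‖ ≤ m := fun t ξ => (hcoer t ξ).trans <| by
    refine mul_le_of_le_one_right hm.le (Real.exp_le_one_iff.2 ?_)
    have : 0 ≤ κ * min (ξ ^ 2) 1 := by positivity
    linarith
  have hctκ : ∀ t ∈ Set.Icc 0 T, c * t ≤ κ / 2 := fun t ht =>
    (mul_le_mul_of_nonneg_left ht.2 hc).trans hcT
  have hsmall : ∀ t ∈ Set.Icc 0 T, ∀ ξ : ℝ, |ξ| ≤ 1 →
      ‖g t ξ‖ ≤ m * Real.exp (-barrierExponent c ε p t ξ) := by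
    intro t ht ξ hξ
    refine (hcoer t ξ).trans ?_
    have h1 : ξ ^ 2 ≤ 1 := (sq_le_one_iff_abs_le_one ξ).2 hξ
    have h2 := barrierExponent_le (ξ := ξ) hc ht.1 hε.le hp1'
    have h3 := mul_le_mul_of_nonneg_right (hctκ t ht) (sq_nonneg ξ)
    have h4 : 0 ≤ κ * ξ ^ 2 := by positivity
    rw [min_eq_left h1]
    gcongr
    linarith
  set L := κ / ε with hL
  have hlarge : ∀ t ∈ Set.Icc 0 T, ∀ ξ : ℝ, 1 ≤ |ξ| → L ≤ |ξ| →
      ‖g t ξ‖ ≤ m * Real.exp (-barrierExponent c ε p t ξ) := by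
    intro t ht ξ hξ hξL
    refine (hgm t ξ).trans (le_mul_of_one_le_right hm.le (Real.one_le_exp ?_))
    have h1 : (1 + ξ ^ 2) ^ p - 1 ≤ |ξ| := by
      refine (rpow_sub_one_le_abs_rpow hp0.le hp1').trans ?_
      exact Real.rpow_le_self_of_one_le hξ (by linarith)
    have h2 : c * t * ((1 + ξ ^ 2) ^ p - 1) ≤ κ / 2 * |ξ| :=
      (mul_le_mul_of_nonneg_left h1 (mul_nonneg hc ht.1)).trans
        (mul_le_mul_of_nonneg_right (hctκ t ht) (abs_nonneg _))
    have h3 : κ ≤ |ξ| * ε := by rwa [hL, div_le_iff₀ hε] at hξL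
    have h4 : κ * |ξ| ≤ |ξ| * ε * |ξ| := by gcongr
    have h5 : |ξ| * ε * |ξ| = ε * ξ ^ 2 := by rw [← sq_abs]; ring
    have h6 : 0 ≤ κ * |ξ| := by positivity
    unfold barrierExponent
    linarith
  set H : ℝ × ℝ → ℝ := fun z => ‖g z.1 z.2‖ * Real.exp (barrierExponent c ε p z.1 z.2) with hH
  have hHc : Continuous H := (hg.norm).mul (Real.continuous_exp.comp continuous_barrierExponent)
  have hiff : ∀ t ξ, ‖g t ξ‖ ≤ m * Real.exp (-barrierExponent c ε p t ξ) ↔ H (t, ξ) ≤ m := by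
    intro t ξ
    simp only [hH]
    rw [Real.exp_neg, ← div_eq_mul_inv, le_div_iff₀ (Real.exp_pos _)]
  by_contra hcon
  push Not at hcon
  obtain ⟨t₁, ht₁, ξ₁, hξ₁⟩ := hcon
  have hξ1 : 1 ≤ |ξ₁| := by
    by_contra h
    exact absurd (hsmall t₁ ht₁ ξ₁ (by linarith)) (not_le.2 hξ₁)
  have hξL : |ξ₁| ≤ L := by
    by_contra h
    exact absurd (hlarge t₁ ht₁ ξ₁ hξ1 (by linarith)) (not_le.2 hξ₁)
  set K : Set (ℝ × ℝ) := (Set.Icc 0 T ×ˢ Set.Icc (-L) L) ∩ {z | 1 ≤ |z.2| ∧ m ≤ H z} with hK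
  have hKc : IsCompact K := by
    refine (isCompact_Icc.prod isCompact_Icc).inter_right ?_
    exact (isClosed_le continuous_const continuous_snd.abs).inter (isClosed_le continuous_const hHc)
  have hKne : K.Nonempty := by
    refine ⟨(t₁, ξ₁), ⟨ht₁, abs_le.1 hξL⟩, hξ1, ?_⟩
    by_contra h
    exact absurd ((hiff t₁ ξ₁).2 (not_le.1 h).le) (not_le.2 hξ₁)
  obtain ⟨⟨t, ξ⟩, ⟨⟨ht, -⟩, hξ, hmH⟩, hmin⟩ := hKc.exists_isMinOn hKne continuous_fst.continuousOn
  simp only at ht hξ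
  have ht0 : 0 < t := by
    rcases ht.1.eq_or_lt with h | h
    · exfalso
      have h1 : H (t, ξ) ≤ m * Real.exp (-(ε * ξ ^ 2)) := by
        simp only [hH, ← h, barrierExponent, mul_zero, zero_mul, zero_sub]
        gcongr
        exact hgm _ _
      have hξ2 : 0 < ξ ^ 2 := by
        rw [← sq_abs]; positivity
      have h2 : Real.exp (-(ε * ξ ^ 2)) < 1 := Real.exp_lt_one_iff.2 (by
        have := mul_pos hε hξ2
        linarith)
      have h3 : m ≤ H (t, ξ) := hmH
      nlinarith
    · exact h
  have hbefore : ∀ τ, 0 ≤ τ → τ < t → ∀ ζ, H (τ, ζ) ≤ m := by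
    intro τ hτ0 hτt ζ
    have hτ : τ ∈ Set.Icc 0 T := ⟨hτ0, hτt.le.trans ht.2⟩
    by_contra hlt
    rw [← hiff] at hlt
    have h1 : 1 ≤ |ζ| := by
      by_contra h
      exact hlt (hsmall τ hτ ζ (by linarith))
    have h2 : |ζ| ≤ L := by
      by_contra h
      exact hlt (hlarge τ hτ ζ h1 (by linarith))
    rw [hiff] at hlt
    have h3 : t ≤ τ := hmin (a := (τ, ζ)) ⟨⟨hτ, abs_le.1 h2⟩, h1, (not_le.1 hlt).le⟩
    linarith
  have hat : ∀ ζ, H (t, ζ) ≤ m := by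
    intro ζ
    have h1 : Filter.Tendsto (fun τ => H (τ, ζ)) (nhdsWithin t (Set.Iio t)) (nhds (H (t, ζ))) :=
      ((hHc.comp (by fun_prop : Continuous fun τ : ℝ => (τ, ζ))).tendsto t).mono_left
        nhdsWithin_le_nhds
    refine le_of_tendsto h1 ?_
    filter_upwards [Ioo_mem_nhdsLT ht0] with τ hτ
    exact hbefore τ hτ.1.le hτ.2 ζ
  have hHeq : H (t, ξ) = m := le_antisymm (hat ξ) hmH
  have hgeq : ‖g t ξ‖ = m * Real.exp (-barrierExponent c ε p t ξ) := by
    rw [Real.exp_neg, ← div_eq_mul_inv, eq_div_iff (Real.exp_pos _).ne']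
    exact hHeq
  have hre := re_integral_kacFourierIntegrand_le hC₀ hs0 hs hm hκ0 hκ1 hp0.le hp1' hc ht.1 hε.le
    (hctκ t ht) (hcoer t) (fun ζ => (hiff t ζ).2 (hat ζ)) hξ (h_int t ξ) hgeq
  set D := ∫ θ in (-(Real.pi / 2))..(Real.pi / 2), kacFourierIntegrand C₀ s m (g t) ξ θ with hD
  set W := (1 + ξ ^ 2) ^ p - 1 with hW
  have hd1 := (hder t ⟨ht0, ht.2⟩ ξ).norm_sq
  have hd2 : HasDerivWithinAt (fun τ => Real.exp (2 * barrierExponent c ε p τ ξ))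
      (Real.exp (2 * barrierExponent c ε p t ξ) * (2 * (c * W))) (Set.Iic t) t := by
    have h0 : HasDerivWithinAt (fun τ => 2 * barrierExponent c ε p τ ξ) (2 * (c * W))
        (Set.Iic t) t := by
      have := ((((hasDerivAt_id t).const_mul c).mul_const W).sub_const (ε * ξ ^ 2)).const_mul 2
      simpa [barrierExponent, hW] using this.hasDerivWithinAt
    exact h0.exp
  have hd := nonneg_of_hasDerivWithinAt_Iic ht0 (hd1.mul hd2) (fun τ hτ0 hτt => by
    have hsq : ∀ τ, ‖g τ ξ‖ ^ 2 * Real.exp (2 * barrierExponent c ε p τ ξ) = H (τ, ξ) ^ 2 := by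
      intro τ
      simp only [hH]
      rw [mul_pow, ← Real.exp_nat_mul]
      norm_num
    simp only [Pi.mul_apply, hsq]
    have h1 : 0 ≤ H (τ, ξ) := by simp only [hH]; positivity
    have := hbefore τ hτ0 hτt ξ
    rw [hHeq]
    gcongr)
  have hB0 : 0 < ‖g t ξ‖ := by rw [hgeq]; positivity
  have hE := Real.exp_pos (2 * barrierExponent c ε p t ξ)
  have hWs : W ≤ |ξ| ^ (2 * s) :=
    (rpow_sub_one_le_abs_rpow hp0.le hp1').trans
      (Real.rpow_le_rpow_of_exponent_le hξ (by linarith))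
  have hr : 0 < |ξ| ^ (2 * s) := Real.rpow_pos_of_pos (by linarith) _
  have hlt : c * W < m * κ * C₀ / 64 * |ξ| ^ (2 * s) :=
    (mul_le_mul_of_nonneg_left hWs hc).trans_lt (mul_lt_mul_of_pos_right hcm hr)
  have hneg : inner ℝ (g t ξ) D + ‖g t ξ‖ ^ 2 * (c * W) < 0 := by
    have := mul_lt_mul_of_pos_left hlt (by positivity : 0 < ‖g t ξ‖ ^ 2)
    linarith
  have := mul_neg_of_neg_of_pos hneg hE
  linarith

lemma norm_le_exp_neg_of_kacFourier {C₀ s m κ p T : ℝ} (hC₀ : 0 < C₀) (hs0 : 0 < s)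
    (hs : s < 1 / 2) (hm : 0 < m) (hκ0 : 0 < κ) (hκ1 : κ ≤ 1) (hp0 : 0 < p) (hp1 : p < s)
    (hT : 0 < T) {g : ℝ → ℝ → ℂ} (hg : Continuous (Function.uncurry g))
    (hcoer : ∀ t ξ, ‖g t ξ‖ ≤ m * Real.exp (-(κ * min (ξ ^ 2) 1)))
    (h_int : ∀ t ξ, IntervalIntegrable (kacFourierIntegrand C₀ s m (g t) ξ) volume
      (-(Real.pi / 2)) (Real.pi / 2))
    (hder : ∀ t ∈ Set.Ioc 0 T, ∀ ξ, HasDerivWithinAt (fun τ => g τ ξ)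
      (∫ θ in (-(Real.pi / 2))..(Real.pi / 2), kacFourierIntegrand C₀ s m (g t) ξ θ)
      (Set.Iic t) t) :
    ∃ c : ℝ, 0 < c ∧ ∀ t ∈ Set.Icc 0 T, ∀ ξ,
      ‖g t ξ‖ ≤ m * Real.exp (-(c * t * ((1 + ξ ^ 2) ^ p - 1))) := by
  set c := min (κ / (2 * T)) (m * κ * C₀ / 128) with hc
  have hc0 : 0 < c := by positivity
  have hcT : c * T ≤ κ / 2 := by
    calc c * T ≤ κ / (2 * T) * T := by gcongr; exact min_le_left _ _
      _ = κ / 2 := by field_simp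
  have hcm : c < m * κ * C₀ / 64 := by
    have h1 : c ≤ m * κ * C₀ / 128 := min_le_right _ _
    have h2 : 0 < m * κ * C₀ := by positivity
    linarith
  refine ⟨c, hc0, fun t ht ξ => ?_⟩
  have hlim : Filter.Tendsto (fun ε => m * Real.exp (-barrierExponent c ε p t ξ))
      (nhdsWithin 0 (Set.Ioi 0)) (nhds (m * Real.exp (-barrierExponent c 0 p t ξ))) := by
    have : Continuous fun ε => m * Real.exp (-barrierExponent c ε p t ξ) := by
      unfold barrierExponent; fun_prop
    exact (this.tendsto 0).mono_left nhdsWithin_le_nhds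
  have h := ge_of_tendsto hlim (b := ‖g t ξ‖) (by
    filter_upwards [self_mem_nhdsWithin] with ε hε
    exact norm_le_exp_neg_barrierExponent hC₀ hs0 hs hm hκ0 hκ1 hp0 hp1 hc0.le hε hcT hcm hg hcoer
      h_int hder t ht ξ)
  simpa [barrierExponent] using h

/-! ### The collision operator tested against oscillations -/

/-- The character `v ↦ e^{-2πivξ}`. -/
def osc (ξ v : ℝ) : ℂ := Complex.exp (-(2 * Real.pi * v * ξ) * Complex.I)

lemma continuous_osc : Continuous (Function.uncurry osc) := by
  unfold osc Function.uncurry; fun_prop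

lemma osc_eq (ξ v : ℝ) :
    osc ξ v = Complex.exp (Complex.I * ((-(2 * Real.pi * v * ξ) : ℝ) : ℂ)) := by
  unfold osc; congr 1; push_cast; ring

lemma norm_osc (ξ v : ℝ) : ‖osc ξ v‖ = 1 := by
  rw [osc_eq, Complex.norm_exp_I_mul_ofReal]

lemma osc_add (ξ v w : ℝ) : osc ξ (v + w) = osc ξ v * osc ξ w := by
  unfold osc; rw [← Complex.exp_add]; congr 1; push_cast; ring

lemma osc_comm (ξ v : ℝ) : osc ξ v = osc v ξ := by
  unfold osc; congr 1; ring

lemma norm_osc_sub_le (ξ v w : ℝ) : ‖osc ξ v - osc ξ w‖ ≤ 2 * Real.pi * |ξ| * |v - w| := by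
  have h1 : osc ξ v - osc ξ w = osc ξ w * (osc ξ (v - w) - 1) := by
    rw [mul_sub, ← osc_add]; simp
  rw [h1, norm_mul, norm_osc, one_mul, osc_eq]
  refine (Real.norm_exp_I_mul_ofReal_sub_one_le).trans (le_of_eq ?_)
  rw [Real.norm_eq_abs, abs_neg, abs_mul, abs_mul, abs_mul, abs_two, abs_of_pos Real.pi_pos]
  ring

lemma re_exp_mul_osc (α ξ v : ℝ) :
    (Complex.exp (-α * Complex.I) * osc ξ v).re = Real.cos (2 * Real.pi * ξ * v + α) := by
  have e : (-α * Complex.I + -(2 * Real.pi * v * ξ) * Complex.I : ℂ)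
      = ((-(2 * Real.pi * ξ * v + α) : ℝ) : ℂ) * Complex.I := by push_cast; ring
  rw [osc, ← Complex.exp_add, e, Complex.exp_ofReal_mul_I_re, Real.cos_neg]

namespace IsBoundedDensity

variable {m Cb : ℝ} {h : ℝ → ℝ}

lemma mass_nonneg (hh : IsBoundedDensity m Cb h) : 0 ≤ m := by
  rw [← hh.mass]; exact integral_nonneg hh.nonneg

lemma integrable_abs_mul (hh : IsBoundedDensity m Cb h) : Integrable fun v => |v| * h v := by
  refine (hh.integrable.add hh.integrable_sq).mono'
    (continuous_abs.aestronglyMeasurable.mul hh.integrable.aestronglyMeasurable)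
    (Filter.Eventually.of_forall fun v => ?_)
  have := hh.nonneg v
  rw [Real.norm_of_nonneg (by positivity), Pi.add_apply, ← sq_abs]
  nlinarith [sq_nonneg (|v| - 1)]

lemma integral_abs_mul_le (hh : IsBoundedDensity m Cb h) : ∫ v, |v| * h v ≤ m + Cb := by
  calc ∫ v, |v| * h v ≤ ∫ v, (h v + v ^ 2 * h v) := by
        refine integral_mono hh.integrable_abs_mul (hh.integrable.add hh.integrable_sq) fun v => ?_
        have := hh.nonneg v
        simp only [← sq_abs v]
        nlinarith [sq_nonneg (|v| - 1)]
    _ = m + ∫ v, v ^ 2 * h v := by rw [integral_add hh.integrable hh.integrable_sq, hh.mass]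
    _ ≤ _ := by linarith [hh.energy_le]

lemma integrable_osc_mul (hh : IsBoundedDensity m Cb h) (ξ : ℝ) :
    Integrable fun v => osc ξ v * (h v : ℂ) :=
  Integrable.bdd_mul (c := 1) hh.integrable.ofReal
    (continuous_osc.comp (by fun_prop : Continuous fun v : ℝ => (ξ, v))).aestronglyMeasurable
    (Filter.Eventually.of_forall fun v => (norm_osc ξ v).le)

lemma norm_FT_sub_le (hh : IsBoundedDensity m Cb h) (ξ η : ℝ) :
    ‖FT (fun v => (h v : ℂ)) ξ - FT (fun v => (h v : ℂ)) η‖ ≤ 2 * Real.pi * (m + Cb) * |ξ - η| := by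
  have e : FT (fun v => (h v : ℂ)) ξ - FT (fun v => (h v : ℂ)) η
      = ∫ v, (osc ξ v * (h v : ℂ) - osc η v * (h v : ℂ)) :=
    (integral_sub (hh.integrable_osc_mul ξ) (hh.integrable_osc_mul η)).symm
  have hb := norm_integral_le_of_norm_le (f := fun v => osc ξ v * (h v : ℂ) - osc η v * (h v : ℂ))
    (hh.integrable_abs_mul.const_mul (2 * Real.pi * |ξ - η|))
    (Filter.Eventually.of_forall fun v => by
      rw [← sub_mul, norm_mul, osc_comm, osc_comm η, Complex.norm_real,
        Real.norm_of_nonneg (hh.nonneg v)]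
      have := mul_le_mul_of_nonneg_right (norm_osc_sub_le v ξ η) (hh.nonneg v)
      linarith)
  rw [MeasureTheory.integral_const_mul] at hb
  rw [e]
  have h2 := mul_le_mul_of_nonneg_left hh.integral_abs_mul_le
    (by positivity : 0 ≤ 2 * Real.pi * |ξ - η|)
  linarith

end IsBoundedDensity

/-- The collision integrand against the character of frequency `ξ`, as a function of
`((v, v_*), θ)`. -/
def kacOscIntegrand (C₀ s : ℝ) (h : ℝ → ℝ) (ξ : ℝ) (z : (ℝ × ℝ) × ℝ) : ℂ :=
  ((kacBeta C₀ s z.2 * h z.1.2 * h z.1.1 : ℝ) : ℂ) *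
    (osc ξ (z.1.1 * Real.cos z.2 - z.1.2 * Real.sin z.2) - osc ξ z.1.1)

/-- The angular weight dominating the cancelled collision integrand. -/
def kacWeight (C₀ s θ : ℝ) : ℝ := kacBeta C₀ s θ * (1 - Real.cos θ + |Real.sin θ|)

lemma kacWeight_nonneg {C₀ : ℝ} (hC₀ : 0 ≤ C₀) (s θ : ℝ) : 0 ≤ kacWeight C₀ s θ :=
  mul_nonneg (kacBeta_nonneg hC₀ s θ) (by linarith [Real.cos_le_one θ, abs_nonneg (Real.sin θ)])

lemma integrableOn_kacWeight {C₀ s : ℝ} (hC₀ : 0 ≤ C₀) (hs0 : 0 < s) (hs : s < 1 / 2) :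
    IntegrableOn (kacWeight C₀ s) (Set.Ioc (-(Real.pi / 2)) (Real.pi / 2)) := by
  have hpi := Real.pi_pos
  have h1 := (intervalIntegrable_iff_integrableOn_Ioc_of_le (by linarith)).1
    (intervalIntegrable_kacBeta_mul_sin hC₀ hs0 hs)
  refine (h1.const_mul 2).mono' ?_ ?_
  · refine Measurable.aestronglyMeasurable ?_
    unfold kacWeight
    exact (measurable_kacBeta C₀ s).mul (by fun_prop)
  · refine (ae_restrict_iff' measurableSet_Ioc).2 (Filter.Eventually.of_forall fun θ hθ => ?_)
    rw [Real.norm_of_nonneg (kacWeight_nonneg hC₀ s θ)]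
    have hcos := Real.cos_nonneg_of_mem_Icc (Set.Ioc_subset_Icc_self hθ)
    have h2 : 1 - Real.cos θ ≤ |Real.sin θ| := by
      have h3 := Real.sin_sq_add_cos_sq θ
      have h4 := Real.abs_sin_le_one θ
      have h5 := Real.cos_le_one θ
      rw [← sq_abs (Real.sin θ)] at h3
      nlinarith [abs_nonneg (Real.sin θ)]
    have := mul_le_mul_of_nonneg_left h2 (kacBeta_nonneg hC₀ s θ)
    unfold kacWeight
    linarith

lemma norm_kacOscIntegrand_le {C₀ s : ℝ} (hC₀ : 0 ≤ C₀) {h : ℝ → ℝ} (hnn : ∀ v, 0 ≤ h v) (ξ : ℝ)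
    (z : (ℝ × ℝ) × ℝ) : ‖kacOscIntegrand C₀ s h ξ z‖ ≤
      (2 * Real.pi * |ξ| * ((|z.1.1| * h z.1.1) * h z.1.2 + h z.1.1 * (|z.1.2| * h z.1.2)))
        * kacWeight C₀ s z.2 := by
  obtain ⟨⟨v, w⟩, θ⟩ := z
  have hβ := kacBeta_nonneg hC₀ s θ
  have hv := hnn v
  have hw := hnn w
  simp only [kacOscIntegrand, kacWeight]
  rw [norm_mul, Complex.norm_real, Real.norm_of_nonneg (by positivity)]
  have h1 := norm_osc_sub_le ξ (v * Real.cos θ - w * Real.sin θ) v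
  have h2 : |v * Real.cos θ - w * Real.sin θ - v|
      ≤ (|v| + |w|) * (1 - Real.cos θ + |Real.sin θ|) := by
    have h3 : v * Real.cos θ - w * Real.sin θ - v
        = -(v * (1 - Real.cos θ)) - w * Real.sin θ := by ring
    have h4 : 0 ≤ 1 - Real.cos θ := by linarith [Real.cos_le_one θ]
    rw [h3]
    refine (abs_sub _ _).trans ?_
    rw [abs_neg, abs_mul, abs_mul, abs_of_nonneg h4]
    have := mul_nonneg (abs_nonneg v) (abs_nonneg (Real.sin θ))
    have := mul_nonneg (abs_nonneg w) h4
    linarith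
  have hpi := Real.pi_pos
  have h5 : ‖osc ξ (v * Real.cos θ - w * Real.sin θ) - osc ξ v‖ ≤
      2 * Real.pi * |ξ| * ((|v| + |w|) * (1 - Real.cos θ + |Real.sin θ|)) :=
    h1.trans (by gcongr)
  refine (mul_le_mul_of_nonneg_left h5 (by positivity)).trans (le_of_eq ?_)
  ring

namespace IsBoundedDensity

variable {m Cb C₀ s : ℝ} {h : ℝ → ℝ}

lemma integrable_prod_bound (hh : IsBoundedDensity m Cb h) (ξ : ℝ) :
    Integrable (fun z : ℝ × ℝ =>
      2 * Real.pi * |ξ| * ((|z.1| * h z.1) * h z.2 + h z.1 * (|z.2| * h z.2)))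
      (volume.prod volume) :=
  ((hh.integrable_abs_mul.mul_prod hh.integrable).add
    (hh.integrable.mul_prod hh.integrable_abs_mul)).const_mul _

lemma integral_prod_bound_le (hh : IsBoundedDensity m Cb h) (ξ : ℝ) :
    ∫ z : ℝ × ℝ, 2 * Real.pi * |ξ| * ((|z.1| * h z.1) * h z.2 + h z.1 * (|z.2| * h z.2))
      ∂(volume.prod volume) ≤ 4 * Real.pi * |ξ| * (m * (m + Cb)) := by
  rw [MeasureTheory.integral_const_mul, integral_add
    (hh.integrable_abs_mul.mul_prod hh.integrable) (hh.integrable.mul_prod hh.integrable_abs_mul),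
    integral_prod_mul (fun v => |v| * h v) h, integral_prod_mul h (fun v => |v| * h v), hh.mass]
  have h1 := mul_le_mul_of_nonneg_left hh.integral_abs_mul_le hh.mass_nonneg
  have h2 := mul_le_mul_of_nonneg_left h1 (by positivity : 0 ≤ 4 * Real.pi * |ξ|)
  linarith

lemma integrable_kacOscIntegrand (hh : IsBoundedDensity m Cb h) (hC₀ : 0 ≤ C₀) (hs0 : 0 < s)
    (hs : s < 1 / 2) (ξ : ℝ) :
    Integrable (kacOscIntegrand C₀ s h ξ) ((volume.prod volume).prod
      (volume.restrict (Set.Ioc (-(Real.pi / 2)) (Real.pi / 2)))) := by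
  refine ((hh.integrable_prod_bound ξ).mul_prod (integrableOn_kacWeight hC₀ hs0 hs)).mono' ?_
    (Filter.Eventually.of_forall fun z => norm_kacOscIntegrand_le hC₀ hh.nonneg ξ z)
  have hm := hh.integrable.aestronglyMeasurable
  unfold kacOscIntegrand
  refine AEStronglyMeasurable.mul ?_ ?_
  · refine Complex.continuous_ofReal.comp_aestronglyMeasurable ?_
    refine AEStronglyMeasurable.mul (AEStronglyMeasurable.mul ?_ ?_) ?_
    · exact ((measurable_kacBeta C₀ s).comp measurable_snd).aestronglyMeasurable
    · exact (hm.comp_snd (μ := volume)).comp_fst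
    · exact (hm.comp_fst (ν := volume)).comp_fst
  · refine Continuous.aestronglyMeasurable ?_
    unfold osc
    fun_prop

lemma integral_kacOscIntegrand (hh : IsBoundedDensity m Cb h) (ξ θ : ℝ) :
    ∫ z : ℝ × ℝ, kacOscIntegrand C₀ s h ξ (z, θ) ∂(volume.prod volume)
      = kacFourierIntegrand C₀ s m (FT fun v => (h v : ℂ)) ξ θ := by
  have i1 := (hh.integrable_osc_mul (ξ * Real.cos θ)).mul_prod
    (hh.integrable_osc_mul (-(ξ * Real.sin θ)))
  have i2 : Integrable (fun z : ℝ × ℝ => (osc ξ z.1 * (h z.1 : ℂ)) * (h z.2 : ℂ))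
      (volume.prod volume) :=
    (hh.integrable_osc_mul ξ).mul_prod (hh.integrable.ofReal (𝕜 := ℂ))
  have e : ∀ z : ℝ × ℝ, kacOscIntegrand C₀ s h ξ (z, θ) = (kacBeta C₀ s θ : ℂ) *
      ((osc (ξ * Real.cos θ) z.1 * (h z.1 : ℂ)) * (osc (-(ξ * Real.sin θ)) z.2 * (h z.2 : ℂ))
        - (osc ξ z.1 * (h z.1 : ℂ)) * (h z.2 : ℂ)) := by
    intro z
    have e1 : osc ξ (z.1 * Real.cos θ - z.2 * Real.sin θ)
        = osc (ξ * Real.cos θ) z.1 * osc (-(ξ * Real.sin θ)) z.2 := by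
      unfold osc
      rw [← Complex.exp_add]
      congr 1
      push_cast
      ring
    simp only [kacOscIntegrand, e1]
    push_cast
    ring
  simp only [e]
  have hmass : ∫ v, (h v : ℂ) = m := by
    rw [← hh.mass]; exact integral_ofReal
  rw [MeasureTheory.integral_const_mul, integral_sub i1 i2,
    integral_prod_mul (fun v => osc (ξ * Real.cos θ) v * (h v : ℂ))
      (fun v => osc (-(ξ * Real.sin θ)) v * (h v : ℂ)),
    integral_prod_mul (fun v => osc ξ v * (h v : ℂ)) (fun v => (h v : ℂ)), hmass,
    kacFourierIntegrand, mul_comm (m : ℂ)]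
  rfl

lemma norm_kacFourierIntegrand_le (hh : IsBoundedDensity m Cb h) (hC₀ : 0 ≤ C₀) (ξ θ : ℝ) :
    ‖kacFourierIntegrand C₀ s m (FT fun v => (h v : ℂ)) ξ θ‖
      ≤ 4 * Real.pi * |ξ| * (m * (m + Cb)) * kacWeight C₀ s θ := by
  rw [← hh.integral_kacOscIntegrand]
  refine (norm_integral_le_of_norm_le ((hh.integrable_prod_bound ξ).mul_const (kacWeight C₀ s θ))
    (Filter.Eventually.of_forall fun z =>
      norm_kacOscIntegrand_le hC₀ hh.nonneg ξ (z, θ))).trans ?_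
  rw [MeasureTheory.integral_mul_const]
  exact mul_le_mul_of_nonneg_right (hh.integral_prod_bound_le ξ) (kacWeight_nonneg hC₀ s θ)

lemma intervalIntegrable_kacFourierIntegrand (hh : IsBoundedDensity m Cb h) (hC₀ : 0 ≤ C₀)
    (hs0 : 0 < s) (hs : s < 1 / 2) (ξ : ℝ) :
    IntervalIntegrable (kacFourierIntegrand C₀ s m (FT fun v => (h v : ℂ)) ξ) volume
      (-(Real.pi / 2)) (Real.pi / 2) := by
  rw [intervalIntegrable_iff_integrableOn_Ioc_of_le (by linarith [Real.pi_pos])]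
  have := (hh.integrable_kacOscIntegrand hC₀ hs0 hs ξ).integral_prod_right
  simp only [hh.integral_kacOscIntegrand] at this
  exact this

lemma integral_collision_cos (hh : IsBoundedDensity m Cb h) (hC₀ : 0 ≤ C₀) (hs0 : 0 < s)
    (hs : s < 1 / 2) (ξ α : ℝ) :
    ∫ v : ℝ, ∫ w : ℝ, ∫ θ in (-(Real.pi / 2))..(Real.pi / 2), kacBeta C₀ s θ * h w * h v *
        (Real.cos (2 * Real.pi * ξ * (v * Real.cos θ - w * Real.sin θ) + α)
          - Real.cos (2 * Real.pi * ξ * v + α))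
      = (Complex.exp (-α * Complex.I) * ∫ θ in (-(Real.pi / 2))..(Real.pi / 2),
          kacFourierIntegrand C₀ s m (FT fun v => (h v : ℂ)) ξ θ).re := by
  have hpi : -(Real.pi / 2) ≤ Real.pi / 2 := by linarith [Real.pi_pos]
  set c := Complex.exp (-α * Complex.I) with hc
  have hG := hh.integrable_kacOscIntegrand hC₀ hs0 hs ξ
  set R : (ℝ × ℝ) × ℝ → ℝ := fun z => (c * kacOscIntegrand C₀ s h ξ z).re with hR
  have hRi : Integrable R ((volume.prod volume).prod
      (volume.restrict (Set.Ioc (-(Real.pi / 2)) (Real.pi / 2)))) := (hG.const_mul c).re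
  have e1 : ∀ v w θ, kacBeta C₀ s θ * h w * h v *
        (Real.cos (2 * Real.pi * ξ * (v * Real.cos θ - w * Real.sin θ) + α)
          - Real.cos (2 * Real.pi * ξ * v + α)) = R ((v, w), θ) := by
    intro v w θ
    simp only [hR, kacOscIntegrand]
    rw [mul_left_comm, Complex.re_ofReal_mul, mul_sub c, Complex.sub_re, re_exp_mul_osc,
      re_exp_mul_osc]
  simp only [e1, intervalIntegral.integral_of_le hpi]
  rw [← integral_prod (fun z : ℝ × ℝ => ∫ θ in Set.Ioc (-(Real.pi / 2)) (Real.pi / 2), R (z, θ))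
    hRi.integral_prod_left, ← integral_prod R hRi]
  have e2 : ∫ z, R z ∂((volume.prod volume).prod
      (volume.restrict (Set.Ioc (-(Real.pi / 2)) (Real.pi / 2)))) =
      (∫ z, c * kacOscIntegrand C₀ s h ξ z ∂((volume.prod volume).prod
      (volume.restrict (Set.Ioc (-(Real.pi / 2)) (Real.pi / 2))))).re :=
    integral_re (hG.const_mul c)
  rw [e2, MeasureTheory.integral_const_mul, integral_prod_symm _ hG]
  simp only [hh.integral_kacOscIntegrand]

lemma integral_mul_cos (hh : IsBoundedDensity m Cb h) (ξ α : ℝ) :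
    ∫ v, h v * Real.cos (2 * Real.pi * ξ * v + α)
      = (Complex.exp (-α * Complex.I) * FT (fun v => (h v : ℂ)) ξ).re := by
  have e : ∀ v, h v * Real.cos (2 * Real.pi * ξ * v + α)
      = (Complex.exp (-α * Complex.I) * (osc ξ v * (h v : ℂ))).re := by
    intro v
    rw [← mul_assoc, Complex.re_mul_ofReal, re_exp_mul_osc, mul_comm]
  simp only [e]
  have := integral_re ((hh.integrable_osc_mul ξ).const_mul (Complex.exp (-α * Complex.I)))
  refine this.trans ?_
  rw [MeasureTheory.integral_const_mul]
  rfl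

end IsBoundedDensity

/-! ### Regularity in time of the Fourier transform -/

lemma max_min_mem_Icc {T : ℝ} (hT : 0 ≤ T) (t : ℝ) : max 0 (min T t) ∈ Set.Icc 0 T :=
  ⟨le_max_left _ _, max_le hT (min_le_left _ _)⟩

lemma max_min_of_mem_Icc {T t : ℝ} (ht : t ∈ Set.Icc 0 T) : max 0 (min T t) = t := by
  rw [min_eq_right ht.2, max_eq_right ht.1]

/-- A function that agrees on `[0, T]` with a constant plus an indefinite integral of a bounded,
not necessarily measurable, function is measurable after clamping its argument to `[0, T]`. -/
lemma measurable_comp_clamp_of_eq_add_integral {u q : ℝ → ℝ} {T C u₀ : ℝ} (hT : 0 ≤ T)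
    (hq : ∀ τ, |q τ| ≤ C)
    (hu : ∀ t ∈ Set.Icc 0 T, u t = u₀ + ∫ τ in (0 : ℝ)..t, q τ) :
    Measurable fun t => u (max 0 (min T t)) := by
  classical
  set J : Set ℝ := {t | t ∈ Set.Icc 0 T ∧ IntervalIntegrable q volume 0 t} with hJ
  have hJm : MeasurableSet J := by
    refine Set.OrdConnected.measurableSet ⟨fun x hx y hy z hz => ?_⟩
    have hz0 : 0 ≤ z := hx.1.1.trans hz.1
    refine ⟨⟨hz0, hz.2.trans hy.1.2⟩, hy.2.mono_set ?_⟩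
    rw [Set.uIcc_of_le hz0, Set.uIcc_of_le hy.1.1]
    exact Set.Icc_subset_Icc_right hz.2
  have hcont : ContinuousOn u J := by
    have hC : 0 ≤ C := (abs_nonneg _).trans (hq 0)
    refine LipschitzOnWith.continuousOn (K := C.toNNReal) (LipschitzOnWith.of_dist_le_mul ?_)
    intro x hx y hy
    rw [Real.dist_eq, Real.dist_eq, Real.coe_toNNReal _ hC, hu x hx.1, hu y hy.1,
      add_sub_add_left_eq_sub, integral_interval_sub_left hx.2 hy.2]
    exact intervalIntegral.norm_integral_le_of_norm_le_const (f := q) fun τ _ => hq τ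
  have hmeas := hcont.measurable_piecewise (continuousOn_const (c := u₀)) hJm
  have hclamp : Continuous fun t : ℝ => max 0 (min T t) := by fun_prop
  convert hmeas.comp hclamp.measurable using 2 with t
  have ht := max_min_mem_Icc hT t
  by_cases hmem : max 0 (min T t) ∈ J
  · simp [hmem]
  · have hni : ¬ IntervalIntegrable q volume 0 (max 0 (min T t)) := fun h => hmem ⟨ht, h⟩
    rw [hu _ ht, integral_undef hni]
    simp [hmem]

/-- The Fourier transform of the collision operator at the density `h`. -/
def kacFourier (C₀ s m : ℝ) (h : ℝ → ℝ) (ξ : ℝ) : ℂ :=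
  ∫ θ in (-(Real.pi / 2))..(Real.pi / 2), kacFourierIntegrand C₀ s m (FT fun v => (h v : ℂ)) ξ θ

lemma re_exp_neg_zero_mul (z : ℂ) : (Complex.exp (-((0 : ℝ) : ℂ) * Complex.I) * z).re = z.re := by
  simp

lemma re_exp_neg_half_pi_mul (z : ℂ) :
    (Complex.exp (-((Real.pi / 2 : ℝ) : ℂ) * Complex.I) * z).re = z.im := by
  have e : Complex.exp (-((Real.pi / 2 : ℝ) : ℂ) * Complex.I) = -Complex.I := by
    rw [← Complex.exp_neg_pi_div_two_mul_I]
    congr 1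
    push_cast
    ring
  rw [e]
  simp

/-- A bounded evolution `F` of densities, frozen outside `[0, T]`, whose Fourier transform obeys
the integrated Kac equation on `[0, T]` in the sense of all real projections. -/
structure IsKacEvolution (C₀ s m Cb T : ℝ) (F : ℝ → ℝ → ℝ) : Prop where
  density : ∀ t, IsBoundedDensity m Cb (F t)
  clamp : ∀ t, F (max 0 (min T t)) = F t
  re_eq : ∀ ξ α : ℝ, ∀ t ∈ Set.Icc 0 T,
    (Complex.exp (-(α : ℂ) * Complex.I) * FT (fun v => (F t v : ℂ)) ξ).re
      = (Complex.exp (-(α : ℂ) * Complex.I) * FT (fun v => (F 0 v : ℂ)) ξ).re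
        + ∫ τ in (0 : ℝ)..t,
          (Complex.exp (-(α : ℂ) * Complex.I) * kacFourier C₀ s m (F τ) ξ).re

section TimeRegularity

variable {m Cb C₀ s T : ℝ} {F : ℝ → ℝ → ℝ}

lemma intervalIntegrable_kacWeight (hC₀ : 0 ≤ C₀) (hs0 : 0 < s) (hs : s < 1 / 2) :
    IntervalIntegrable (kacWeight C₀ s) volume (-(Real.pi / 2)) (Real.pi / 2) :=
  (intervalIntegrable_iff_integrableOn_Ioc_of_le (by linarith [Real.pi_pos])).2
    (integrableOn_kacWeight hC₀ hs0 hs)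

lemma IsBoundedDensity.norm_kacFourier_le {h : ℝ → ℝ} (hh : IsBoundedDensity m Cb h)
    (hC₀ : 0 ≤ C₀) (hs0 : 0 < s) (hs : s < 1 / 2) (ξ : ℝ) :
    ‖kacFourier C₀ s m h ξ‖ ≤ ∫ θ in (-(Real.pi / 2))..(Real.pi / 2),
      4 * Real.pi * |ξ| * (m * (m + Cb)) * kacWeight C₀ s θ :=
  norm_integral_le_of_norm_le (by linarith [Real.pi_pos])
    (Filter.Eventually.of_forall fun θ _ => hh.norm_kacFourierIntegrand_le hC₀ ξ θ)
    ((intervalIntegrable_kacWeight hC₀ hs0 hs).const_mul _)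

lemma IsBoundedDensity.continuous_FT {h : ℝ → ℝ} (hh : IsBoundedDensity m Cb h) :
    Continuous (FT fun v => (h v : ℂ)) := by
  refine LipschitzWith.continuous (K := (2 * Real.pi * (m + Cb)).toNNReal)
    (LipschitzWith.of_dist_le_mul fun ξ η => ?_)
  rw [dist_eq_norm, Real.dist_eq]
  exact (hh.norm_FT_sub_le ξ η).trans
    (mul_le_mul_of_nonneg_right (Real.le_coe_toNNReal _) (abs_nonneg _))

lemma measurable_FT_clamp (hT : 0 ≤ T) (hC₀ : 0 ≤ C₀) (hs0 : 0 < s) (hs : s < 1 / 2)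
    (hF : IsKacEvolution C₀ s m Cb T F) (ξ : ℝ) :
    Measurable fun t => FT (fun v => (F t v : ℂ)) ξ := by
  have key : ∀ α : ℝ, Measurable fun t =>
      (Complex.exp (-(α : ℂ) * Complex.I) * FT (fun v => (F t v : ℂ)) ξ).re := by
    intro α
    have hq : ∀ τ, |(Complex.exp (-(α : ℂ) * Complex.I) * kacFourier C₀ s m (F τ) ξ).re| ≤
        ∫ θ in (-(Real.pi / 2))..(Real.pi / 2),
          4 * Real.pi * |ξ| * (m * (m + Cb)) * kacWeight C₀ s θ := by
      intro τ
      refine (Complex.abs_re_le_norm _).trans ?_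
      have e : ‖Complex.exp (-(α : ℂ) * Complex.I)‖ = 1 := by
        have := Complex.norm_exp_ofReal_mul_I (-α)
        rwa [Complex.ofReal_neg] at this
      rw [norm_mul, e, one_mul]
      exact (hF.density τ).norm_kacFourier_le hC₀ hs0 hs ξ
    have := measurable_comp_clamp_of_eq_add_integral hT hq (hF.re_eq ξ α)
    simpa only [hF.clamp] using this
  have h0 := key 0
  have h1 := key (Real.pi / 2)
  simp only [re_exp_neg_zero_mul] at h0
  simp only [re_exp_neg_half_pi_mul] at h1
  exact measurable_of_re_im (𝕜 := ℂ) h0 h1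

lemma stronglyMeasurable_integral_kacFourierIntegrand {g : ℝ → ℝ → ℂ}
    (hcont : ∀ t, Continuous (g t)) (hmeas : ∀ ξ, Measurable fun t => g t ξ) (ξ : ℝ) :
    StronglyMeasurable fun t =>
      ∫ θ in (-(Real.pi / 2))..(Real.pi / 2), kacFourierIntegrand C₀ s m (g t) ξ θ := by
  have hu : Measurable (Function.uncurry fun ξ t => g t ξ) :=
    measurable_uncurry_of_continuous_of_measurable hcont hmeas
  have hcomp : ∀ k : ℝ → ℝ, Measurable k → Measurable fun z : ℝ × ℝ => g z.1 (k z.2) :=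
    fun k hk => hu.comp ((hk.comp measurable_snd).prodMk measurable_fst)
  have hβ : Measurable fun z : ℝ × ℝ => (kacBeta C₀ s z.2 : ℂ) :=
    Complex.measurable_ofReal.comp ((measurable_kacBeta C₀ s).comp measurable_snd)
  have hz : Measurable fun z : ℝ × ℝ => kacFourierIntegrand C₀ s m (g z.1) ξ z.2 :=
    hβ.mul (((hcomp (fun θ => ξ * Real.cos θ) (by fun_prop)).mul
      (hcomp (fun θ => -(ξ * Real.sin θ)) (by fun_prop))).sub
        ((hcomp (fun _ => ξ) measurable_const).const_mul (m : ℂ)))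
  simp only [intervalIntegral.integral_of_le (by linarith [Real.pi_pos] :
    -(Real.pi / 2) ≤ Real.pi / 2)]
  exact hz.stronglyMeasurable.integral_prod_right'

lemma FT_eq_add_integral (hT : 0 ≤ T) (hC₀ : 0 ≤ C₀) (hs0 : 0 < s) (hs : s < 1 / 2)
    (hF : IsKacEvolution C₀ s m Cb T F) (ξ : ℝ) :
    (∀ a b, IntervalIntegrable (fun τ => kacFourier C₀ s m (F τ) ξ) volume a b) ∧
    ∀ t ∈ Set.Icc 0 T, FT (fun v => (F t v : ℂ)) ξ
      = FT (fun v => (F 0 v : ℂ)) ξ + ∫ τ in (0 : ℝ)..t, kacFourier C₀ s m (F τ) ξ := by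
  have h_int : ∀ a b, IntervalIntegrable (fun τ => kacFourier C₀ s m (F τ) ξ) volume a b :=
    fun a b => (intervalIntegrable_const (c := ∫ θ in (-(Real.pi / 2))..(Real.pi / 2),
      4 * Real.pi * |ξ| * (m * (m + Cb)) * kacWeight C₀ s θ)).mono_fun'
      (stronglyMeasurable_integral_kacFourierIntegrand (fun t => (hF.density t).continuous_FT)
        (measurable_FT_clamp hT hC₀ hs0 hs hF) ξ).aestronglyMeasurable
      (Filter.Eventually.of_forall fun τ => (hF.density τ).norm_kacFourier_le hC₀ hs0 hs ξ)
  refine ⟨h_int, fun t ht => ?_⟩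
  have h0 := hF.re_eq ξ 0 t ht
  have h1 := hF.re_eq ξ (Real.pi / 2) t ht
  simp only [re_exp_neg_zero_mul] at h0
  simp only [re_exp_neg_half_pi_mul] at h1
  have hre := Complex.reCLM.intervalIntegral_comp_comm (h_int 0 t)
  have him := Complex.imCLM.intervalIntegral_comp_comm (h_int 0 t)
  simp only [Complex.reCLM_apply] at hre
  simp only [Complex.imCLM_apply] at him
  apply Complex.ext
  · rw [Complex.add_re, h0, hre]
  · rw [Complex.add_im, h1, him]

lemma continuous_FT_clamp (hT : 0 ≤ T) (hC₀ : 0 ≤ C₀) (hs0 : 0 < s) (hs : s < 1 / 2)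
    (hF : IsKacEvolution C₀ s m Cb T F) :
    Continuous (Function.uncurry fun t ξ => FT (fun v => (F t v : ℂ)) ξ) := by
  refine continuous_prod_of_continuous_lipschitzWith' _ (2 * Real.pi * (m + Cb)).toNNReal
    (fun t => LipschitzWith.of_dist_le_mul fun ξ η => ?_) (fun ξ => ?_)
  · rw [dist_eq_norm, Real.dist_eq]
    exact ((hF.density t).norm_FT_sub_le ξ η).trans
      (mul_le_mul_of_nonneg_right (Real.le_coe_toNNReal _) (abs_nonneg _))
  · obtain ⟨h_int, heq⟩ := FT_eq_add_integral hT hC₀ hs0 hs hF ξ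
    have e : (fun t => Function.uncurry (fun t ξ => FT (fun v => (F t v : ℂ)) ξ) (t, ξ))
        = fun t => FT (fun v => (F 0 v : ℂ)) ξ
          + ∫ τ in (0 : ℝ)..(max 0 (min T t)), kacFourier C₀ s m (F τ) ξ := by
      funext t
      rw [← heq _ (max_min_mem_Icc hT t), hF.clamp]
      rfl
    rw [e]
    exact continuous_const.add ((continuous_primitive h_int 0).comp (by fun_prop))

lemma hasDerivWithinAt_FT (hT : 0 ≤ T) (hC₀ : 0 ≤ C₀) (hs0 : 0 < s) (hs : s < 1 / 2)
    (hF : IsKacEvolution C₀ s m Cb T F)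
    {t : ℝ} (ht : t ∈ Set.Ioc 0 T) (ξ : ℝ) :
    HasDerivWithinAt (fun τ => FT (fun v => (F τ v : ℂ)) ξ) (kacFourier C₀ s m (F t) ξ)
      (Set.Iic t) t := by
  have hg := continuous_FT_clamp hT hC₀ hs0 hs hF
  have hcont : Continuous fun τ => kacFourier C₀ s m (F τ) ξ := by
    refine intervalIntegral.continuous_of_dominated_interval
      (fun τ => (intervalIntegrable_iff.1
        ((hF.density τ).intervalIntegrable_kacFourierIntegrand hC₀ hs0 hs ξ)).aestronglyMeasurable)
      (fun τ => Filter.Eventually.of_forall fun θ _ =>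
        (hF.density τ).norm_kacFourierIntegrand_le hC₀ ξ θ)
      ((intervalIntegrable_kacWeight hC₀ hs0 hs).const_mul _)
      (Filter.Eventually.of_forall fun θ _ => ?_)
    have hcomp : ∀ η : ℝ, Continuous fun τ => FT (fun v => (F τ v : ℂ)) η := fun η =>
      hg.comp (by fun_prop : Continuous fun τ : ℝ => (τ, η))
    unfold kacFourierIntegrand
    exact continuous_const.mul (((hcomp _).mul (hcomp _)).sub (continuous_const.mul (hcomp _)))
  obtain ⟨-, heq⟩ := FT_eq_add_integral hT hC₀ hs0 hs hF ξ
  have hd := ((hcont.integral_hasStrictDerivAt 0 t).hasDerivAt.const_add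
    (FT (fun v => (F 0 v : ℂ)) ξ)).hasDerivWithinAt (s := Set.Iic t)
  refine hd.congr_of_eventuallyEq ?_ (heq t (Set.Ioc_subset_Icc_self ht))
  filter_upwards [Ioc_mem_nhdsLE ht.1] with τ hτ
  exact heq τ ⟨hτ.1.le, hτ.2.trans ht.2⟩

end TimeRegularity

/-! ### Weak solutions -/

lemma one_add_sq_le_jap_rpow {s : ℝ} (hs : 0 ≤ s) (v : ℝ) : 1 + v ^ 2 ≤ jap v ^ (2 + 2 * s) := by
  have h1 : 1 ≤ jap v := Real.one_le_sqrt.2 (by nlinarith [sq_nonneg v])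
  calc 1 + v ^ 2 = jap v ^ (2 : ℝ) := by
        rw [Real.rpow_two, jap, Real.sq_sqrt (by positivity)]
    _ ≤ _ := Real.rpow_le_rpow_of_exponent_le h1 (by linarith)

lemma jap_rpow_two_mul (p ξ : ℝ) : jap ξ ^ (2 * p) = (1 + ξ ^ 2) ^ p := by
  rw [jap, Real.rpow_mul (Real.sqrt_nonneg _), Real.rpow_two, Real.sq_sqrt (by positivity)]

lemma isBoundedDensity_of_integrable_jap {m Cb s : ℝ} (hs : 0 ≤ s) {h : ℝ → ℝ}
    (hnn : ∀ v, 0 ≤ h v) (hmass : ∫ v, h v = m)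
    (hjap : Integrable fun v => jap v ^ (2 + 2 * s) * h v)
    (hlog : Integrable fun v => h v * Real.log (1 + h v))
    (hjap_le : ∫ v, jap v ^ (2 + 2 * s) * h v ≤ Cb)
    (hlog_le : ∫ v, h v * Real.log (1 + h v) ≤ Cb) : IsBoundedDensity m Cb h := by
  have hpos : ∀ v, 0 < jap v ^ (2 + 2 * s) := fun v =>
    lt_of_lt_of_le (by positivity) (one_add_sq_le_jap_rpow hs v)
  have hmeas : AEStronglyMeasurable h volume := by
    have hj : Measurable fun v => (jap v ^ (2 + 2 * s))⁻¹ := by unfold jap; fun_prop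
    refine (hj.aestronglyMeasurable.mul hjap.aestronglyMeasurable).congr
      (Filter.Eventually.of_forall fun v => ?_)
    exact inv_mul_cancel_left₀ (hpos v).ne' (h v)
  have hle : ∀ v, (1 + v ^ 2) * h v ≤ jap v ^ (2 + 2 * s) * h v := fun v =>
    mul_le_mul_of_nonneg_right (one_add_sq_le_jap_rpow hs v) (hnn v)
  have hsq : Integrable fun v => v ^ 2 * h v := by
    refine hjap.mono' ((continuous_pow 2).aestronglyMeasurable.mul hmeas)
      (Filter.Eventually.of_forall fun v => ?_)
    rw [Real.norm_of_nonneg (mul_nonneg (sq_nonneg v) (hnn v))]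
    linarith [hle v, hnn v]
  refine ⟨hnn, hjap.mono' hmeas (Filter.Eventually.of_forall fun v => ?_), hmass, hsq,
    (integral_mono hsq hjap fun v => ?_).trans hjap_le, hlog, hlog_le⟩
  · rw [Real.norm_of_nonneg (hnn v)]
    linarith [hle v, mul_nonneg (sq_nonneg v) (hnn v)]
  · linarith [hle v, hnn v]

lemma deriv_cos_mul_add (k α : ℝ) :
    (deriv fun w => Real.cos (k * w + α)) = fun w => -Real.sin (k * w + α) * k := by
  funext v
  exact ((((hasDerivAt_id v).const_mul k).add_const α).cos.congr_deriv (by simp)).deriv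

lemma deriv_deriv_cos_mul_add (k α v : ℝ) :
    deriv (deriv fun w => Real.cos (k * w + α)) v = -(Real.cos (k * v + α) * k) * k := by
  rw [deriv_cos_mul_add]
  exact (((((hasDerivAt_id v).const_mul k).add_const α).sin.neg.mul_const k).congr_deriv
    (by simp)).deriv

lemma IsWeakKacSolution.integral_mul_cos_eq {C₀ s T : ℝ} {f₀ : ℝ → ℝ} {f : ℝ → ℝ → ℝ}
    (hf : IsWeakKacSolution C₀ s T f₀ f) (k α : ℝ) {t : ℝ} (ht : t ∈ Set.Icc 0 T) :
    ∫ v, f t v * Real.cos (k * v + α) = (∫ v, f 0 v * Real.cos (k * v + α))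
      + ∫ τ in (0 : ℝ)..t, ∫ v : ℝ, ∫ w : ℝ, ∫ θ in (-(Real.pi / 2))..(Real.pi / 2),
          kacBeta C₀ s θ * f τ w * f τ v *
            (Real.cos (k * (v * Real.cos θ - w * Real.sin θ) + α) - Real.cos (k * v + α)) := by
  have key := hf.weak_eq (fun _ v => Real.cos (k * v + α)) (fun _ _ => 0)
    (fun v t => hasDerivAt_const t _) (fun _ => by fun_prop)
    ⟨1 + |k| + |k| * |k|, fun t v => ?_⟩
  · have h0 := key 0 ⟨le_rfl, ht.1.trans ht.2⟩
    have h1 := key t ht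
    simp only [mul_zero, MeasureTheory.integral_zero, intervalIntegral.integral_zero, zero_add,
      intervalIntegral.integral_same] at h0 h1
    linarith
  · have hk := abs_nonneg k
    have hk2 := mul_nonneg hk hk
    have hc := Real.abs_cos_le_one (k * v + α)
    have hs := Real.abs_sin_le_one (k * v + α)
    rw [deriv_deriv_cos_mul_add, deriv_cos_mul_add]
    refine ⟨by linarith, by rw [abs_zero]; linarith, ?_, ?_⟩
    · rw [abs_mul, abs_neg]
      nlinarith
    · rw [abs_mul, abs_neg, abs_mul]
      nlinarith

lemma IsWeakKacSolution.isKacEvolution {C₀ s T m Cb : ℝ} {f₀ : ℝ → ℝ} {f : ℝ → ℝ → ℝ}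
    (hf : IsWeakKacSolution C₀ s T f₀ f) (hC₀ : 0 ≤ C₀) (hs0 : 0 < s) (hs : s < 1 / 2)
    (hT : 0 ≤ T) (hd : ∀ t ∈ Set.Icc 0 T, IsBoundedDensity m Cb (f t)) :
    IsKacEvolution C₀ s m Cb T fun t => f (max 0 (min T t)) := by
  have hF : ∀ t, IsBoundedDensity m Cb (f (max 0 (min T t))) := fun t =>
    hd _ (max_min_mem_Icc hT t)
  refine ⟨hF, fun t => by rw [max_min_of_mem_Icc (max_min_mem_Icc hT t)], fun ξ α t ht => ?_⟩
  rw [← (hF t).integral_mul_cos, ← (hF 0).integral_mul_cos, max_min_of_mem_Icc ht,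
    max_min_of_mem_Icc ⟨le_rfl, hT⟩, hf.integral_mul_cos_eq _ _ ht]
  congr 1
  refine intervalIntegral.integral_congr fun τ hτ => ?_
  rw [Set.uIcc_of_le ht.1] at hτ
  have hτ' : τ ∈ Set.Icc 0 T := ⟨hτ.1, hτ.2.trans ht.2⟩
  simp only [max_min_of_mem_Icc hτ']
  exact (hd τ hτ').integral_collision_cos hC₀ hs0 hs ξ α

lemma integrable_exp_neg_mul_one_add_sq_rpow {b p : ℝ} (hb : 0 < b) (hp : 0 < p) :
    Integrable fun ξ : ℝ => Real.exp (-(b * (1 + ξ ^ 2) ^ p)) := by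
  obtain ⟨n, hn⟩ := exists_nat_ge (1 / p)
  refine (integrable_inv_one_add_sq.const_mul ((n.factorial : ℝ) / b ^ n)).mono'
    (Measurable.aestronglyMeasurable (by fun_prop)) (Filter.Eventually.of_forall fun ξ => ?_)
  have hy : 1 ≤ 1 + ξ ^ 2 := by linarith [sq_nonneg ξ]
  have hy0 : 0 < 1 + ξ ^ 2 := by linarith
  have h1 := Real.pow_div_factorial_le_exp (b * (1 + ξ ^ 2) ^ p) (by positivity) n
  have h2 : 1 + ξ ^ 2 ≤ ((1 + ξ ^ 2) ^ p) ^ n := by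
    rw [← Real.rpow_mul_natCast hy0.le]
    refine Real.self_le_rpow_of_one_le hy ?_
    rwa [div_le_iff₀ hp, mul_comm] at hn
  have h3 : b ^ n * (1 + ξ ^ 2) / n.factorial ≤ Real.exp (b * (1 + ξ ^ 2) ^ p) := by
    refine le_trans ?_ h1
    rw [mul_pow]
    gcongr
  rw [Real.norm_of_nonneg (Real.exp_nonneg _), Real.exp_neg]
  refine (inv_anti₀ (by positivity) h3).trans (le_of_eq ?_)
  field_simp

lemma integrable_exp_mul_sq_of_norm_le {m b p : ℝ} (hb : 0 < b) (hp : 0 < p) {u : ℝ → ℂ}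
    (hu : Continuous u) (hle : ∀ ξ, ‖u ξ‖ ≤ m * Real.exp (-(b * ((1 + ξ ^ 2) ^ p - 1)))) :
    Integrable fun ξ : ℝ => Real.exp (2 * (b / 2) * jap ξ ^ (2 * p)) * ‖u ξ‖ ^ 2 := by
  refine ((integrable_exp_neg_mul_one_add_sq_rpow hb hp).const_mul
    (m ^ 2 * Real.exp (2 * b))).mono' ?_ (Filter.Eventually.of_forall fun ξ => ?_)
  · refine Measurable.aestronglyMeasurable ?_
    refine Measurable.mul ?_ (hu.norm.pow 2).measurable
    unfold jap
    fun_prop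
  · rw [Real.norm_of_nonneg (by positivity), jap_rpow_two_mul]
    calc _ ≤ Real.exp (2 * (b / 2) * (1 + ξ ^ 2) ^ p)
          * (m * Real.exp (-(b * ((1 + ξ ^ 2) ^ p - 1)))) ^ 2 := by
          gcongr
          exact hle ξ
      _ = m ^ 2 * (Real.exp (2 * (b / 2) * (1 + ξ ^ 2) ^ p)
          * (Real.exp (-(b * ((1 + ξ ^ 2) ^ p - 1)))) ^ 2) := by ring
      _ = m ^ 2 * (Real.exp (2 * b) * Real.exp (-(b * (1 + ξ ^ 2) ^ p))) := by
          rw [← Real.exp_nat_mul, ← Real.exp_add, ← Real.exp_add]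
          congr 2
          push_cast
          ring
      _ = _ := by ring

/-- Gevrey regularizing effect of the Cauchy problem for the non-cutoff
homogeneous Kac equation: if `0 < s < 1/2`, `f₀ ∈ L¹_{2+2s} ∩ L log L` is
nonnegative and not identically zero, and
`f ∈ L∞([0,T₀]; L¹_{2+2s} ∩ L log L)` is a nonnegative weak solution, then for
every `0 < s' < s` there is `0 < T* ≤ T₀` such that `f(t,·) ∈ G^{1/(2s')}(ℝ)`
for all `0 < t ≤ T*`, i.e. `∫ e^{2c⟨ξ⟩^{2s'}}|𝓕f(t)(ξ)|² dξ < ∞` for some `c > 0`. -/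
theorem kac_gevrey_regularizing_effect
    (C₀ s T₀ : ℝ) (hC₀ : 0 < C₀) (hs0 : 0 < s) (hs : s < 1 / 2) (hT₀ : 0 < T₀)
    (f₀ : ℝ → ℝ) (f : ℝ → ℝ → ℝ)
    (hf₀nn : ∀ v, 0 ≤ f₀ v) (hf₀ne : 0 < ∫ v : ℝ, f₀ v)
    (hf₀L1 : Integrable fun v : ℝ => jap v ^ (2 + 2 * s) * f₀ v)
    (hf₀LL : Integrable fun v : ℝ => f₀ v * Real.log (1 + f₀ v))
    (hfLinf : ∃ Cb : ℝ, ∀ t ∈ Set.Icc (0 : ℝ) T₀,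
        (Integrable fun v : ℝ => jap v ^ (2 + 2 * s) * f t v) ∧
        (Integrable fun v : ℝ => f t v * Real.log (1 + f t v)) ∧
        (∫ v : ℝ, jap v ^ (2 + 2 * s) * f t v) ≤ Cb ∧
        (∫ v : ℝ, f t v * Real.log (1 + f t v)) ≤ Cb)
    (hweak : IsWeakKacSolution C₀ s T₀ f₀ f) :
    ∀ s' : ℝ, 0 < s' → s' < s →
      ∃ Tstar : ℝ, 0 < Tstar ∧ Tstar ≤ T₀ ∧
        ∀ t : ℝ, 0 < t → t ≤ Tstar →
          ∃ c : ℝ, 0 < c ∧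
            Integrable fun ξ : ℝ =>
              Real.exp (2 * c * jap ξ ^ (2 * s'))
                * ‖FT (fun v => (f t v : ℂ)) ξ‖ ^ 2 := by
  intro s' hs'0 hs's
  obtain ⟨Cb, hCb⟩ := hfLinf
  have hd : ∀ t ∈ Set.Icc 0 T₀, IsBoundedDensity (∫ v, f₀ v) Cb (f t) := fun t ht =>
    isBoundedDensity_of_integrable_jap hs0.le (hweak.nonneg t ht) (hweak.mass t ht)
      (hCb t ht).1 (hCb t ht).2.1 (hCb t ht).2.2.1 (hCb t ht).2.2.2
  have hF := hweak.isKacEvolution hC₀.le hs0 hs hT₀.le hd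
  obtain ⟨κ, hκ0, hκ1, hcoer⟩ := exists_norm_FT_le (Cb := Cb) hf₀ne
  obtain ⟨c, hc, hbound⟩ := norm_le_exp_neg_of_kacFourier hC₀ hs0 hs hf₀ne hκ0 hκ1 hs'0 hs's hT₀
    (continuous_FT_clamp hT₀.le hC₀.le hs0 hs hF) (fun t ξ => hcoer _ (hF.density t) ξ)
    (fun t ξ => (hF.density t).intervalIntegrable_kacFourierIntegrand hC₀.le hs0 hs ξ)
    (fun t ht ξ => hasDerivWithinAt_FT hT₀.le hC₀.le hs0 hs hF ht ξ)
  refine ⟨T₀, hT₀, le_rfl, fun t ht htT => ⟨c * t / 2, by positivity, ?_⟩⟩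
  have htI : t ∈ Set.Icc 0 T₀ := ⟨ht.le, htT⟩
  have hb := hbound t htI
  simp only [max_min_of_mem_Icc htI] at hb
  exact integrable_exp_mul_sq_of_norm_le (mul_pos hc ht) hs'0 (hd t htI).continuous_FT hb
end
end

section
/- Let β̃ : (−π/2, π/2) → [0, ∞) be integrable and let f, g ∈ L¹(ℝ). Define the cutoff Kac collision operator K(f,g)(v) = ∫_{−π/2}^{π/2} ∫_ℝ β̃(θ) [f(v_*') g(v') − f(v_*) g(v)] dv_* dθ. Then K(f,g) ∈ L¹(ℝ) and for every ξ ∈ ℝ the Bobylev formula holds: 𝓕(K(f,g))(ξ) = ∫_{−π/2}^{π/2} β̃(θ) [𝓕f(ξ sin θ) 𝓕g(ξ cos θ) − 𝓕f(0) 𝓕g(ξ)] dθ. -/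
open MeasureTheory Real intervalIntegral

noncomputable section

/-- The cutoff Kac collision operator associated with an angular kernel `β̃`:
`K(f,g)(v) = ∫∫ β̃(θ) [f(v⋆')g(v') − f(v⋆)g(v)] dv⋆ dθ` where
`v' = v cos θ − v⋆ sin θ` and `v⋆' = v sin θ + v⋆ cos θ`. -/
def kacOpCutoff (betaT : ℝ → ℝ) (f g : ℝ → ℝ) (v : ℝ) : ℝ :=
  ∫ θ in (-(Real.pi / 2))..(Real.pi / 2), ∫ vs : ℝ,
    betaT θ * (f (v * Real.sin θ + vs * Real.cos θ) * g (v * Real.cos θ - vs * Real.sin θ)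
      - f vs * g v)

/-- The rotation `(v, v⋆) ↦ (v', v⋆')` of the Kac collision rule. -/
def kacRotation (θ : ℝ) (p : ℝ × ℝ) : ℝ × ℝ :=
  (p.1 * Real.cos θ - p.2 * Real.sin θ, p.1 * Real.sin θ + p.2 * Real.cos θ)

theorem measurePreserving_kacRotation (θ : ℝ) : MeasurePreserving (kacRotation θ) := by
  have hrot := (rotation (Circle.exp θ)).measurePreserving
  have h := (Complex.volume_preserving_equiv_real_prod.comp hrot).comp
    Complex.volume_preserving_equiv_real_prod.symm
  convert h using 1
  funext p
  have hexp : Complex.exp (θ * Complex.I) = ⟨Real.cos θ, Real.sin θ⟩ := by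
    apply Complex.ext <;> simp [Complex.exp_ofReal_mul_I_re, Complex.exp_ofReal_mul_I_im]
  ext <;> simp [kacRotation, hexp, Complex.measurableEquivRealProd_apply,
    Complex.measurableEquivRealProd_symm_apply] <;> ring

theorem measurePreserving_skew_kacRotation (ν : Measure ℝ) [SFinite ν] :
    MeasurePreserving (fun q : ℝ × ℝ × ℝ => (q.1, kacRotation q.1 q.2))
      (ν.prod volume) (ν.prod volume) := by
  refine (MeasurePreserving.id ν).skew_product (g := kacRotation) ?_
    (.of_forall fun θ => (measurePreserving_kacRotation θ).map_eq)
  unfold kacRotation Function.uncurry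
  fun_prop

/-- The difference of the gain and loss integrands `f(v⋆')g(v') − f(v⋆)g(v)`. -/
def kacDiff (f g : ℝ → ℝ) (θ : ℝ) (p : ℝ × ℝ) : ℝ :=
  f (kacRotation θ p).2 * g (kacRotation θ p).1 - f p.2 * g p.1

theorem integrable_snd_mul_fst {f g : ℝ → ℝ} (hf : Integrable f) (hg : Integrable g) :
    Integrable (fun p : ℝ × ℝ => f p.2 * g p.1) := by
  simpa only [mul_comm, Measure.volume_eq_prod] using hg.mul_prod hf

theorem integrable_gain {f g : ℝ → ℝ} (hf : Integrable f) (hg : Integrable g) (θ : ℝ) :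
    Integrable (fun p : ℝ × ℝ => f (kacRotation θ p).2 * g (kacRotation θ p).1) :=
  (measurePreserving_kacRotation θ).integrable_comp_of_integrable (integrable_snd_mul_fst hf hg)

theorem integrable_mul_kacDiff {ν : Measure ℝ} [SFinite ν] {b f g : ℝ → ℝ} (hb : Integrable b ν)
    (hf : Integrable f) (hg : Integrable g) :
    Integrable (fun q : ℝ × ℝ × ℝ => b q.1 * kacDiff f g q.1 q.2) (ν.prod volume) := by
  have hloss := hb.mul_prod (integrable_snd_mul_fst hf hg)
  have hgain := (measurePreserving_skew_kacRotation ν).integrable_comp_of_integrable hloss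
  exact (hgain.sub hloss).congr (.of_forall fun q => (mul_sub _ _ _).symm)

theorem integrable_integral_mul_kacDiff {ν : Measure ℝ} [SFinite ν] {b f g : ℝ → ℝ}
    (hb : Integrable b ν) (hf : Integrable f) (hg : Integrable g) :
    Integrable (fun q : ℝ × ℝ => ∫ vs, b q.1 * kacDiff f g q.1 (q.2, vs)) (ν.prod volume) :=
  ((measurePreserving_prodAssoc ν volume volume).integrable_comp_of_integrable
    (integrable_mul_kacDiff hb hf hg)).integral_prod_left

/-- The Fourier character `v ↦ e^{-2πivξ}`. -/
def fourierKernel (ξ v : ℝ) : ℂ := Complex.exp (-(2 * Real.pi * v * ξ) * Complex.I)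

theorem continuous_fourierKernel (ξ : ℝ) : Continuous (fourierKernel ξ) := by
  unfold fourierKernel
  fun_prop

theorem norm_fourierKernel (ξ v : ℝ) : ‖fourierKernel ξ v‖ = 1 := by
  have h : -(2 * (Real.pi : ℂ) * v * ξ) * Complex.I
      = ((-(2 * Real.pi * v * ξ) : ℝ) : ℂ) * Complex.I := by push_cast; ring
  rw [fourierKernel, h, Complex.norm_exp_ofReal_mul_I]

theorem integrable_fourierKernel_mul {α : Type*} [MeasurableSpace α] {μ : Measure α} {u : α → ℝ}
    (hu : Integrable u μ) (ξ : ℝ) {w : α → ℝ} (hw : Measurable w) :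
    Integrable (fun a => fourierKernel ξ (w a) * (u a : ℂ)) μ :=
  hu.ofReal.bdd_mul (c := 1) ((continuous_fourierKernel ξ).measurable.comp hw).aestronglyMeasurable
    (.of_forall fun a => (norm_fourierKernel ξ (w a)).le)

theorem integral_fourierKernel_mul_loss (f g : ℝ → ℝ) (ξ : ℝ) :
    ∫ p : ℝ × ℝ, fourierKernel ξ p.1 * ((f p.2 * g p.1 : ℝ) : ℂ)
      = FT (fun v => (f v : ℂ)) 0 * FT (fun v => (g v : ℂ)) ξ := by
  rw [mul_comm, FT, FT, ← integral_prod_mul]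
  refine integral_congr_ae (.of_forall fun p => ?_)
  simp only [fourierKernel]
  push_cast
  simp
  ring

theorem integral_fourierKernel_mul_gain (f g : ℝ → ℝ) (ξ θ : ℝ) :
    ∫ p : ℝ × ℝ, fourierKernel ξ p.1 *
        ((f (kacRotation θ p).2 * g (kacRotation θ p).1 : ℝ) : ℂ)
      = FT (fun v => (f v : ℂ)) (ξ * Real.sin θ) * FT (fun v => (g v : ℂ)) (ξ * Real.cos θ) := by
  have hinv : ∀ p : ℝ × ℝ, kacRotation θ (kacRotation (-θ) p) = p := by
    intro p
    have h := Real.sin_sq_add_cos_sq θ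
    ext <;> simp only [kacRotation, Real.cos_neg, Real.sin_neg]
    · linear_combination p.1 * h
    · linear_combination p.2 * h
  have hinv' : ∀ p : ℝ × ℝ, kacRotation (-θ) (kacRotation θ p) = p := by
    intro p
    have h := Real.sin_sq_add_cos_sq θ
    ext <;> simp only [kacRotation, Real.cos_neg, Real.sin_neg]
    · linear_combination p.1 * h
    · linear_combination p.2 * h
  have hemb : MeasurableEmbedding (kacRotation (-θ)) :=
    (MeasurableEquiv.mk ⟨kacRotation (-θ), kacRotation θ, hinv, hinv'⟩
      (measurePreserving_kacRotation (-θ)).measurable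
      (measurePreserving_kacRotation θ).measurable).measurableEmbedding
  rw [← (measurePreserving_kacRotation (-θ)).integral_comp hemb, mul_comm, FT, FT,
    ← integral_prod_mul]
  refine integral_congr_ae (.of_forall fun p => ?_)
  simp only [hinv]
  have hexp : fourierKernel ξ (kacRotation (-θ) p).1
      = fourierKernel (ξ * Real.cos θ) p.1 * fourierKernel (ξ * Real.sin θ) p.2 := by
    simp only [fourierKernel, kacRotation, Real.cos_neg, Real.sin_neg, ← Complex.exp_add]
    congr 1
    push_cast
    ring
  rw [hexp]
  simp only [fourierKernel]
  push_cast
  ring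

theorem integral_fourierKernel_mul_kacDiff {f g : ℝ → ℝ} (hf : Integrable f) (hg : Integrable g)
    (b ξ θ : ℝ) :
    ∫ v, fourierKernel ξ v * ((∫ vs, b * kacDiff f g θ (v, vs) : ℝ) : ℂ)
      = (b : ℂ) * (FT (fun v => (f v : ℂ)) (ξ * Real.sin θ)
            * FT (fun v => (g v : ℂ)) (ξ * Real.cos θ)
          - FT (fun v => (f v : ℂ)) 0 * FT (fun v => (g v : ℂ)) ξ) := by
  have hgain := integrable_fourierKernel_mul (integrable_gain hf hg θ) ξ measurable_fst
  have hloss := integrable_fourierKernel_mul (integrable_snd_mul_fst hf hg) ξ measurable_fst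
  have hdiff : Integrable (fun p : ℝ × ℝ => fourierKernel ξ p.1 * (kacDiff f g θ p : ℂ)) :=
    integrable_fourierKernel_mul ((integrable_gain hf hg θ).sub (integrable_snd_mul_fst hf hg)) ξ
      measurable_fst
  calc _ = ∫ v, (b : ℂ) * ∫ vs, fourierKernel ξ v * (kacDiff f g θ (v, vs) : ℂ) := by
        congr 1
        funext v
        rw [MeasureTheory.integral_const_mul, MeasureTheory.integral_const_mul, Complex.ofReal_mul,
          integral_complex_ofReal]
        ring
    _ = (b : ℂ) * ∫ p : ℝ × ℝ, fourierKernel ξ p.1 * (kacDiff f g θ p : ℂ) := by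
        rw [MeasureTheory.integral_const_mul, Measure.volume_eq_prod, integral_prod _ hdiff]
    _ = _ := by
        rw [← integral_fourierKernel_mul_gain, ← integral_fourierKernel_mul_loss,
          ← MeasureTheory.integral_sub hgain hloss]
        simp only [kacDiff, Complex.ofReal_sub, mul_sub]

/-- Bobylev's formula for the cutoff Kac operator: if `β̃ ≥ 0` is integrable on
`(−π/2,π/2)` and `f, g ∈ L¹(ℝ)`, then `K(f,g) ∈ L¹(ℝ)` and
`𝓕(K(f,g))(ξ) = ∫ β̃(θ) [𝓕f(ξ sin θ) 𝓕g(ξ cos θ) − 𝓕f(0) 𝓕g(ξ)] dθ`. -/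
theorem kac_bobylev (betaT : ℝ → ℝ) (hpos : ∀ θ, 0 ≤ betaT θ)
    (hint : IntegrableOn betaT (Set.Ioo (-(Real.pi / 2)) (Real.pi / 2)))
    (f g : ℝ → ℝ) (hf : Integrable f) (hg : Integrable g) :
    Integrable (kacOpCutoff betaT f g) ∧
    ∀ ξ : ℝ,
      FT (fun v => (kacOpCutoff betaT f g v : ℂ)) ξ
        = ∫ θ in (-(Real.pi / 2))..(Real.pi / 2),
            (betaT θ : ℂ) *
              (FT (fun v => (f v : ℂ)) (ξ * Real.sin θ)
                  * FT (fun v => (g v : ℂ)) (ξ * Real.cos θ)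
                - FT (fun v => (f v : ℂ)) 0 * FT (fun v => (g v : ℂ)) ξ) := by
  have hle : -(Real.pi / 2) ≤ Real.pi / 2 := by linarith [Real.pi_pos]
  have hb : Integrable betaT (volume.restrict (Set.Ioc (-(Real.pi / 2)) (Real.pi / 2))) :=
    (integrableOn_Ioc_iff_integrableOn_Ioo).2 hint
  have hJ := integrable_integral_mul_kacDiff hb hf hg
  have hK : kacOpCutoff betaT f g = fun v => ∫ θ in Set.Ioc (-(Real.pi / 2)) (Real.pi / 2),
      ∫ vs, betaT θ * kacDiff f g θ (v, vs) := by
    funext v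
    rw [kacOpCutoff, integral_of_le hle]
    rfl
  rw [hK]
  refine ⟨hJ.integral_prod_right, fun ξ => ?_⟩
  rw [integral_of_le hle]
  simp only [← integral_fourierKernel_mul_kacDiff hf hg]
  rw [integral_integral_swap (integrable_fourierKernel_mul hJ ξ measurable_snd)]
  simp only [MeasureTheory.integral_const_mul, integral_complex_ofReal]
  rfl
end
end

section
/- Fix c₀ > 0, 0 < s' < 1/2 and T > 0. There exists C > 0, depending only on c₀, s' and T (in particular independent of δ), such that for every 0 < δ < 1, every 0 ≤ t ≤ T and every ξ ∈ ℝ: |∂_t G_δ(t,ξ)| ≤ c₀ ⟨ξ⟩^{2s'} G_δ(t,ξ), |∂_ξ G_δ(t,ξ)| ≤ 2s' c₀ t ⟨ξ⟩^{2s'−1} G_δ(t,ξ), and |∂²_ξ G_δ(t,ξ)| ≤ C ⟨ξ⟩^{2(2s'−1)} G_δ(t,ξ). -/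
open MeasureTheory Real

noncomputable section

/-- The exponential mollifier
`G_δ(t,ξ) = e^{c₀ t ⟨ξ⟩^{2s'}} / (1 + δ e^{c₀ t ⟨ξ⟩^{2s'}})`. -/
def Gmol (c₀ s' δ t ξ : ℝ) : ℝ :=
  Real.exp (c₀ * t * jap ξ ^ (2 * s')) / (1 + δ * Real.exp (c₀ * t * jap ξ ^ (2 * s')))

lemma jap_pos (v : ℝ) : 0 < jap v := Real.sqrt_pos.2 (by positivity)

lemma jap_sq (v : ℝ) : jap v ^ 2 = 1 + v ^ 2 := Real.sq_sqrt (by positivity)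

lemma one_le_jap (v : ℝ) : 1 ≤ jap v := by
  nlinarith [jap_sq v, jap_pos v, sq_nonneg v]

lemma abs_le_jap (v : ℝ) : |v| ≤ jap v :=
  abs_le_of_sq_le_sq (by linarith [jap_sq v]) (jap_pos v).le

lemma jap_rpow_mul_sq (v a : ℝ) : jap v ^ (a - 2) * jap v ^ 2 = jap v ^ a := by
  rw [← Real.rpow_natCast, ← Real.rpow_add (jap_pos v)]
  norm_num

lemma jap_rpow_mul_self (v a : ℝ) : jap v ^ (a - 2) * jap v = jap v ^ (a - 1) := by
  nth_rewrite 2 [← Real.rpow_one (jap v)]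
  rw [← Real.rpow_add (jap_pos v)]
  ring_nf

lemma hasDerivAt_jap_rpow (a v : ℝ) :
    HasDerivAt (fun x => jap x ^ a) (a * (v * jap v ^ (a - 2))) v := by
  have h1 : HasDerivAt (fun x : ℝ => 1 + x ^ 2) (2 * v) v := by
    simpa using (hasDerivAt_pow 2 v).const_add 1
  have h2 : HasDerivAt jap (2 * v / (2 * jap v)) v := h1.sqrt (by positivity)
  refine (h2.rpow_const (p := a) (Or.inl (jap_pos v).ne')).congr_deriv ?_
  have h3 := jap_rpow_mul_self v a
  have := (jap_pos v).ne'
  rw [← h3]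
  field_simp

lemma abs_mul_jap_rpow_le (a v : ℝ) : |v * jap v ^ (a - 2)| ≤ jap v ^ (a - 1) := by
  have h := Real.rpow_nonneg (jap_pos v).le (a - 2)
  rw [abs_mul, abs_of_nonneg h, ← jap_rpow_mul_self, mul_comm]
  exact mul_le_mul_of_nonneg_left (abs_le_jap v) h

lemma hasDerivAt_mul_jap_rpow (a v : ℝ) :
    HasDerivAt (fun x => x * jap x ^ (a - 2))
      (jap v ^ (a - 2) + v * ((a - 2) * (v * jap v ^ (a - 2 - 2)))) v := by
  refine ((hasDerivAt_id v).mul (hasDerivAt_jap_rpow (a - 2) v)).congr_deriv ?_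
  simp

lemma abs_deriv_mul_jap_rpow_le {a : ℝ} (ha0 : 0 ≤ a) (ha2 : a ≤ 2) (v : ℝ) :
    |jap v ^ (a - 2) + v * ((a - 2) * (v * jap v ^ (a - 2 - 2)))| ≤ jap v ^ (a - 2) := by
  have h := Real.rpow_nonneg (jap_pos v).le (a - 2 - 2)
  rw [← jap_rpow_mul_sq v (a - 2), jap_sq, abs_le]
  generalize jap v ^ (a - 2 - 2) = p at h ⊢
  have h1 : 0 ≤ p * v ^ 2 := by positivity
  constructor <;> nlinarith [mul_nonneg h1 ha0, mul_nonneg h1 (sub_nonneg.2 ha2)]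

/-- The saturated exponential `e^y / (1 + δ e^y)`. -/
def satExp (δ y : ℝ) : ℝ := Real.exp y / (1 + δ * Real.exp y)

/-- The damping factor `1 / (1 + δ e^y)`, the logarithmic derivative of `satExp δ`. -/
def satDamp (δ y : ℝ) : ℝ := 1 / (1 + δ * Real.exp y)

lemma satExp_pos {δ : ℝ} (hδ : 0 < δ) (y : ℝ) : 0 < satExp δ y := by
  unfold satExp; positivity

lemma satDamp_pos {δ : ℝ} (hδ : 0 < δ) (y : ℝ) : 0 < satDamp δ y := by
  unfold satDamp; positivity

lemma satDamp_le_one {δ : ℝ} (hδ : 0 < δ) (y : ℝ) : satDamp δ y ≤ 1 := by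
  unfold satDamp
  rw [div_le_one (by positivity)]
  have : 0 < δ * Real.exp y := by positivity
  linarith

lemma hasDerivAt_satExp {δ : ℝ} (hδ : 0 < δ) (y : ℝ) :
    HasDerivAt (satExp δ) (satExp δ y * satDamp δ y) y := by
  have h0 : 1 + δ * Real.exp y ≠ 0 := by positivity
  refine ((Real.hasDerivAt_exp y).div
    (((Real.hasDerivAt_exp y).const_mul δ).const_add 1) h0).congr_deriv ?_
  unfold satExp satDamp
  field_simp
  ring

lemma hasDerivAt_satDamp {δ : ℝ} (hδ : 0 < δ) (y : ℝ) :
    HasDerivAt (satDamp δ) (-(satDamp δ y * (1 - satDamp δ y))) y := by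
  have h0 : 1 + δ * Real.exp y ≠ 0 := by positivity
  refine ((hasDerivAt_const y (1 : ℝ)).div
    (((Real.hasDerivAt_exp y).const_mul δ).const_add 1) h0).congr_deriv ?_
  unfold satDamp
  field_simp
  ring

lemma hasDerivAt_satExp_comp {δ : ℝ} (hδ : 0 < δ) {f : ℝ → ℝ} {f' x : ℝ}
    (hf : HasDerivAt f f' x) :
    HasDerivAt (fun x => satExp δ (f x)) (satExp δ (f x) * satDamp δ (f x) * f') x :=
  (hasDerivAt_satExp hδ (f x)).comp x hf

lemma abs_deriv_satExp_comp_le {δ : ℝ} (hδ : 0 < δ) {f : ℝ → ℝ} {f' x B : ℝ}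
    (hf : HasDerivAt f f' x) (hB : |f'| ≤ B) :
    |deriv (fun x => satExp δ (f x)) x| ≤ B * satExp δ (f x) := by
  have hg := satExp_pos hδ (f x)
  have hh := satDamp_pos hδ (f x)
  rw [(hasDerivAt_satExp_comp hδ hf).deriv, abs_mul, abs_mul, abs_of_pos hg, abs_of_pos hh,
    mul_assoc, mul_comm]
  refine mul_le_mul_of_nonneg_right ?_ hg.le
  nlinarith [satDamp_le_one hδ (f x), abs_nonneg f']

lemma abs_deriv_deriv_satExp_comp_le {δ : ℝ} (hδ : 0 < δ) {f f' : ℝ → ℝ} {f'' x : ℝ}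
    (hf : ∀ x, HasDerivAt f (f' x) x) (hf' : HasDerivAt f' f'' x) :
    |deriv (deriv fun x => satExp δ (f x)) x| ≤ (f' x ^ 2 + |f''|) * satExp δ (f x) := by
  have hg := satExp_pos hδ (f x)
  have hh := satDamp_pos hδ (f x)
  have hh1 := satDamp_le_one hδ (f x)
  have hd : deriv (fun x => satExp δ (f x)) =
      fun x => satExp δ (f x) * satDamp δ (f x) * f' x :=
    funext fun y => (hasDerivAt_satExp_comp hδ (hf y)).deriv
  have hdamp : HasDerivAt (fun x => satDamp δ (f x))
      (-(satDamp δ (f x) * (1 - satDamp δ (f x))) * f' x) x :=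
    (hasDerivAt_satDamp hδ (f x)).comp x (hf x)
  have key : deriv (deriv fun x => satExp δ (f x)) x =
      (satDamp δ (f x) * ((2 * satDamp δ (f x) - 1) * f' x ^ 2 + f'')) * satExp δ (f x) := by
    rw [hd]
    refine (((hasDerivAt_satExp_comp hδ (hf x)).mul hdamp).mul hf').deriv.trans ?_
    simp only [Pi.mul_apply]
    ring
  rw [key, abs_mul, abs_of_pos hg, abs_mul, abs_of_pos hh]
  refine mul_le_mul_of_nonneg_right ?_ hg.le
  have h1 : |(2 * satDamp δ (f x) - 1) * f' x ^ 2 + f''| ≤ f' x ^ 2 + |f''| := by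
    refine (abs_add_le _ _).trans (add_le_add_left ?_ _)
    rw [abs_mul, abs_of_nonneg (sq_nonneg (f' x))]
    exact mul_le_of_le_one_left (sq_nonneg _) (abs_le.2 ⟨by linarith, by linarith⟩)
  exact (mul_le_of_le_one_left (abs_nonneg _) hh1).trans h1

/-- Symbolic estimates for the exponential mollifier `G_δ`:
`|∂_t G_δ| ≤ c₀⟨ξ⟩^{2s'} G_δ`, `|∂_ξ G_δ| ≤ 2s'c₀t⟨ξ⟩^{2s'-1} G_δ` and
`|∂²_ξ G_δ| ≤ C⟨ξ⟩^{2(2s'-1)} G_δ`, with `C` independent of `δ`. -/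
theorem Gmol_derivative_bounds (c₀ s' T : ℝ) (hc₀ : 0 < c₀) (hs'0 : 0 < s')
    (hs' : s' < 1 / 2) (hT : 0 < T) :
    ∃ C : ℝ, 0 < C ∧ ∀ δ : ℝ, 0 < δ → δ < 1 → ∀ t : ℝ, 0 ≤ t → t ≤ T → ∀ ξ : ℝ,
      |deriv (fun τ : ℝ => Gmol c₀ s' δ τ ξ) t| ≤ c₀ * jap ξ ^ (2 * s') * Gmol c₀ s' δ t ξ ∧
      |deriv (fun ζ : ℝ => Gmol c₀ s' δ t ζ) ξ|
        ≤ 2 * s' * c₀ * t * jap ξ ^ (2 * s' - 1) * Gmol c₀ s' δ t ξ ∧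
      |deriv (deriv (fun ζ : ℝ => Gmol c₀ s' δ t ζ)) ξ|
        ≤ C * jap ξ ^ (2 * (2 * s' - 1)) * Gmol c₀ s' δ t ξ := by
  refine ⟨(2 * s' * c₀ * T) ^ 2 + 2 * s' * c₀ * T, by positivity, ?_⟩
  intro δ hδ _ t ht htT ξ
  have hφt : HasDerivAt (fun τ : ℝ => c₀ * τ * jap ξ ^ (2 * s')) (c₀ * jap ξ ^ (2 * s')) t := by
    simpa using ((hasDerivAt_id t).const_mul c₀).mul_const (jap ξ ^ (2 * s'))
  have hφ : ∀ ζ : ℝ, HasDerivAt (fun ζ : ℝ => c₀ * t * jap ζ ^ (2 * s'))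
      (c₀ * t * (2 * s' * (ζ * jap ζ ^ (2 * s' - 2)))) ζ :=
    fun ζ => (hasDerivAt_jap_rpow (2 * s') ζ).const_mul (c₀ * t)
  have hφ' := ((hasDerivAt_mul_jap_rpow (2 * s') ξ).const_mul (2 * s')).const_mul (c₀ * t)
  have hB : |c₀ * t * (2 * s' * (ξ * jap ξ ^ (2 * s' - 2)))|
      ≤ 2 * s' * c₀ * t * jap ξ ^ (2 * s' - 1) := by
    rw [← mul_assoc, abs_mul, abs_of_nonneg (by positivity)]
    refine (mul_le_mul_of_nonneg_left (abs_mul_jap_rpow_le (2 * s') ξ)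
      (by positivity)).trans_eq ?_
    ring
  have hJ := Real.rpow_nonneg (jap_pos ξ).le (2 * s' - 1)
  refine ⟨abs_deriv_satExp_comp_le hδ hφt (abs_of_nonneg ?_).le,
    abs_deriv_satExp_comp_le hδ (hφ ξ) hB,
    (abs_deriv_deriv_satExp_comp_le hδ hφ hφ').trans
      (mul_le_mul_of_nonneg_right ?_ (satExp_pos hδ _).le)⟩
  · exact mul_nonneg hc₀.le (Real.rpow_nonneg (jap_pos ξ).le _)
  have hsq : jap ξ ^ (2 * (2 * s' - 1)) = (jap ξ ^ (2 * s' - 1)) ^ 2 := by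
    rw [mul_comm, Real.rpow_mul (jap_pos ξ).le, Real.rpow_two]
  have htT' : 2 * s' * c₀ * t ≤ 2 * s' * c₀ * T := by gcongr
  rw [add_mul]
  refine add_le_add ?_ ?_
  · rw [hsq, ← mul_pow, ← sq_abs]
    exact pow_le_pow_left₀ (abs_nonneg _) (hB.trans (mul_le_mul_of_nonneg_right htT' hJ)) 2
  · rw [← mul_assoc, abs_mul, abs_of_nonneg (by positivity : 0 ≤ c₀ * t * (2 * s'))]
    refine mul_le_mul (by linarith) ?_ (abs_nonneg _) (by positivity)
    exact (abs_deriv_mul_jap_rpow_le (by linarith) (by linarith) ξ).trans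
      (Real.rpow_le_rpow_of_exponent_le (one_le_jap ξ) (by linarith))
end
end

section
/- Fix c₀ > 0 and 0 < s' < 1/2. For every 0 < δ < 1, every t ≥ 0, every ξ ∈ ℝ and every θ ∈ ℝ: G_δ(t,ξ) ≤ 3 G_δ(t, ξ cos θ) G_δ(t, ξ sin θ). -/
open MeasureTheory Real

noncomputable section

theorem jap_nonneg (v : ℝ) : 0 ≤ jap v := Real.sqrt_nonneg _

theorem jap_le_add (ξ θ : ℝ) :
    jap ξ ≤ jap (ξ * Real.cos θ) + jap (ξ * Real.sin θ) := by
  have hb := jap_nonneg (ξ * Real.cos θ)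
  have hc := jap_nonneg (ξ * Real.sin θ)
  have hb2 : jap (ξ * Real.cos θ) ^ 2 = 1 + (ξ * Real.cos θ) ^ 2 :=
    Real.sq_sqrt (by positivity)
  have hc2 : jap (ξ * Real.sin θ) ^ 2 = 1 + (ξ * Real.sin θ) ^ 2 :=
    Real.sq_sqrt (by positivity)
  have hξ : ξ ^ 2 = (ξ * Real.cos θ) ^ 2 + (ξ * Real.sin θ) ^ 2 := by
    linear_combination -ξ ^ 2 * Real.sin_sq_add_cos_sq θ
  refine Real.sqrt_le_iff.mpr ⟨add_nonneg hb hc, ?_⟩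
  nlinarith [mul_nonneg hb hc]

theorem jap_rpow_le_add {p : ℝ} (hp0 : 0 ≤ p) (hp1 : p ≤ 1) (ξ θ : ℝ) :
    jap ξ ^ p ≤ jap (ξ * Real.cos θ) ^ p + jap (ξ * Real.sin θ) ^ p :=
  (Real.rpow_le_rpow (jap_nonneg _) (jap_le_add ξ θ) hp0).trans
    (Real.rpow_add_le_add_rpow (jap_nonneg _) (jap_nonneg _) hp0 hp1)

/-- The map `x ↦ x / (1 + δ x)` is submultiplicative up to the factor `3` on `[1, ∞)`. -/
theorem div_one_add_mul_le {δ A B C : ℝ} (hδ0 : 0 ≤ δ) (hδ1 : δ ≤ 1) (hA : 0 ≤ A)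
    (hB : 1 ≤ B) (hC : 1 ≤ C) (hABC : A ≤ B * C) :
    A / (1 + δ * A) ≤ 3 * (B / (1 + δ * B)) * (C / (1 + δ * C)) := by
  have hBC : 0 ≤ B * C := by positivity
  have hmono : A / (1 + δ * A) ≤ B * C / (1 + δ * (B * C)) := by
    rw [div_le_div_iff₀ (by positivity) (by positivity)]
    linarith
  have hden : (1 + δ * B) * (1 + δ * C) ≤ 3 * (1 + δ * (B * C)) := by
    have h1 : δ * B ≤ δ * (B * C) :=
      mul_le_mul_of_nonneg_left (le_mul_of_one_le_right (by linarith) hC) hδ0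
    have h2 : δ * C ≤ δ * (B * C) :=
      mul_le_mul_of_nonneg_left (le_mul_of_one_le_left (by linarith) hB) hδ0
    have h3 : δ * (δ * (B * C)) ≤ δ * (B * C) :=
      mul_le_of_le_one_left (by positivity) hδ1
    linarith
  calc A / (1 + δ * A) ≤ B * C / (1 + δ * (B * C)) := hmono
    _ ≤ 3 * (B * C) / ((1 + δ * B) * (1 + δ * C)) := by
        rw [div_le_div_iff₀ (by positivity) (by positivity)]
        linarith [mul_le_mul_of_nonneg_left hden hBC]
    _ = 3 * (B / (1 + δ * B)) * (C / (1 + δ * C)) := by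
        rw [mul_assoc, div_mul_div_comm, mul_div_assoc]

/-- Submultiplicativity of the exponential mollifier along the Kac rotation:
`G_δ(t,ξ) ≤ 3 G_δ(t,ξcosθ) G_δ(t,ξsinθ)`. -/
theorem Gmol_submultiplicative (c₀ s' : ℝ) (hc₀ : 0 < c₀) (hs'0 : 0 < s')
    (hs' : s' < 1 / 2) :
    ∀ δ : ℝ, 0 < δ → δ < 1 → ∀ t : ℝ, 0 ≤ t → ∀ ξ θ : ℝ,
      Gmol c₀ s' δ t ξ
        ≤ 3 * Gmol c₀ s' δ t (ξ * Real.cos θ) * Gmol c₀ s' δ t (ξ * Real.sin θ) := by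
  intro δ hδ0 hδ1 t ht ξ θ
  have hct : 0 ≤ c₀ * t := mul_nonneg hc₀.le ht
  have one_le (v : ℝ) : 1 ≤ Real.exp (c₀ * t * jap v ^ (2 * s')) :=
    Real.one_le_exp (mul_nonneg hct (Real.rpow_nonneg (jap_nonneg v) _))
  refine div_one_add_mul_le hδ0.le hδ1.le (Real.exp_pos _).le (one_le _) (one_le _) ?_
  rw [← Real.exp_add, ← mul_add]
  exact Real.exp_le_exp.mpr
    (mul_le_mul_of_nonneg_left (jap_rpow_le_add (by linarith) (by linarith) ξ θ) hct)
end
end
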